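/- Let n ≥ 4 be even and let C be a real symmetric positive definite n×n matrix with n distinct eigenvalues, and let ν ≥ 0. Let S = {G ∈ so(n) : [C, G²] = 0} be the set of steady (stationary) directions. Then there exist a subset 𝒮 ⊆ S, open and dense in S in the induced topology, and an open dense subset 𝒫 ⊆ so(n) × so(n), such that for every G¹ ∈ 𝒮 and every pair (G², G³) ∈ 𝒫 the damped Euler–Frahm system with three torques, I_C(Ω̇(t)) = [C, Ω(t)²] − ν·I_C(Ω(t)) + u₁(t)·I_C(G¹) + u₂(t)·I_C(G²) + u₃(t)·I_C(G³) (where I_C(X) = XC + CX), is globally controllable: every pair of skew-symmetric matrices Ω̃, Ω̂ can be joined, for some T ≥ 0, by a piecewise C¹ solution corresponding to piecewise constant controls u₁, u₂, u₃. -/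

import Mathlib

open Matrix Set

/-- Square real matrices of size `n`. -/
abbrev Mat (n : ℕ) := Matrix (Fin n) (Fin n) ℝ

/-- The inertia operator `I_C(X) = XC + CX` of the multidimensional rigid body. -/
def IC {n : ℕ} (C X : Mat n) : Mat n := X * C + C * X

/-- Matrix commutator `[A, B] = AB - BA`. -/
def mbracket {n : ℕ} (A B : Mat n) : Mat n := A * B - B * A

/-- A matrix is skew-symmetric, i.e. belongs to `so(n)`. -/
def IsSkew {n : ℕ} (X : Mat n) : Prop := Xᵀ = -X

/-- `Steers C ν G Ω₀ Ω₁` : there are a time `T ≥ 0`, piecewise constant controls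
`u j : [0,T] → ℝ` and a piecewise `C¹` curve `Ω : [0,T] → so(n)` with `Ω 0 = Ω₀`,
`Ω T = Ω₁`, solving the controlled damped Euler–Frahm equation
`I_C(Ω̇) = [C, Ω²] − ν I_C(Ω) + Σⱼ uⱼ(t) I_C(Gʲ)` on each subinterval of constancy. -/
def Steers {n m : ℕ} (C : Mat n) (ν : ℝ) (G : Fin m → Mat n) (Ω₀ Ω₁ : Mat n) : Prop :=
  ∃ (T : ℝ) (u : Fin m → ℝ → ℝ) (Ω : ℝ → Mat n) (k : ℕ) (t : ℕ → ℝ),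
    0 ≤ T ∧ t 0 = 0 ∧ t k = T ∧
    (∀ i, i < k → t i < t (i + 1)) ∧
    ContinuousOn Ω (Icc 0 T) ∧
    (∀ s ∈ Icc (0 : ℝ) T, IsSkew (Ω s)) ∧
    Ω 0 = Ω₀ ∧ Ω T = Ω₁ ∧
    (∀ i, i < k → ∀ j : Fin m, ∃ c : ℝ, ∀ s ∈ Ioo (t i) (t (i + 1)), u j s = c) ∧
    (∀ i, i < k → ∀ s ∈ Ioo (t i) (t (i + 1)), ∃ D : Mat n,
      (∀ p q : Fin n, HasDerivAt (fun τ => Ω τ p q) (D p q) s) ∧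
      IC C D = mbracket C ((Ω s) ^ 2) - ν • IC C (Ω s) + ∑ j, u j s • IC C (G j))


namespace MRB
open Filter Topology

/-- solutions on the unit interval of an autonomous equation -/
def Sol {E : Type*} [NormedAddCommGroup E] [NormedSpace ℝ E] (f : E → E) (γ : ℝ → E) : Prop :=
  ∀ t ∈ Icc (0:ℝ) 1, HasDerivWithinAt γ (f (γ t)) (Icc 0 1) t

abbrev Par (E : Type*) [NormedAddCommGroup E] [NormedSpace ℝ E] := ℝ × (E →L[ℝ] E) × E × E

section germ
variable {E : Type*} [NormedAddCommGroup E] [NormedSpace ℝ E]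

/-- the parametrized family of quadratic fields -/
noncomputable def fld (B : E →L[ℝ] E →L[ℝ] E) (p : Par E) (x : E) : E := p.1 • B x x + p.2.1 x + p.2.2.1

lemma Sol.continuousOn {f : E → E} {γ : ℝ → E} (h : Sol f γ) : ContinuousOn γ (Icc 0 1) :=
  fun t ht => (h t ht).continuousWithinAt

lemma Sol.congr {f g : E → E} {γ : ℝ → E} (h : Sol f γ) (hfg : ∀ x, f x = g x) : Sol g γ := by
  have : f = g := funext hfg
  rwa [← this]

/-- pointwise application of a bilinear map to continuous functions -/
noncomputable def nem {F G H : Type*} [NormedAddCommGroup F] [NormedSpace ℝ F]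
    [NormedAddCommGroup G] [NormedSpace ℝ G] [NormedAddCommGroup H] [NormedSpace ℝ H]
    (M : F →L[ℝ] G →L[ℝ] H) (p : C(unitInterval, F) × C(unitInterval, G)) : C(unitInterval, H) :=
  ⟨fun t => M (p.1 t) (p.2 t), by fun_prop⟩

lemma nem_bilin {F G H : Type*} [NormedAddCommGroup F] [NormedSpace ℝ F]
    [NormedAddCommGroup G] [NormedSpace ℝ G] [NormedAddCommGroup H] [NormedSpace ℝ H]
    (M : F →L[ℝ] G →L[ℝ] H) : IsBoundedBilinearMap ℝ (nem M) where
  add_left x y z := by ext t; simp [nem]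
  smul_left c x y := by ext t; simp [nem]
  add_right x y z := by ext t; simp [nem]
  smul_right c x y := by ext t; simp [nem]
  bound := by
    refine ⟨‖M‖ + 1, by positivity, fun x y => ?_⟩
    rw [ContinuousMap.norm_le _ (by positivity)]
    intro t
    calc ‖M (x t) (y t)‖ ≤ ‖M‖ * ‖x t‖ * ‖y t‖ := M.le_opNorm₂ _ _
      _ ≤ (‖M‖ + 1) * ‖x‖ * ‖y‖ := by
        gcongr
        · linarith
        · exact x.norm_coe_le_norm t
        · exact y.norm_coe_le_norm t

lemma nem_zero_right {F G H : Type*} [NormedAddCommGroup F] [NormedSpace ℝ F]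
    [NormedAddCommGroup G] [NormedSpace ℝ G] [NormedAddCommGroup H] [NormedSpace ℝ H]
    (M : F →L[ℝ] G →L[ℝ] H) (x : C(unitInterval, F)) : nem M (x, 0) = 0 := by
  ext t; simp [nem]

noncomputable def cst (F : Type*) [NormedAddCommGroup F] [NormedSpace ℝ F] :
    F →L[ℝ] C(unitInterval, F) :=
  LinearMap.mkContinuous
    { toFun := fun x => ContinuousMap.const _ x
      map_add' := fun x y => by ext; simp
      map_smul' := fun c x => by ext; simp } 1 (fun x => by
        rw [ContinuousMap.norm_le _ (by positivity)]
        intro t; simp)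

@[simp] lemma cst_apply {F : Type*} [NormedAddCommGroup F] [NormedSpace ℝ F] (x : F)
    (t : unitInterval) : cst F x t = x := rfl

/-- integration from zero -/
noncomputable def Jop (F : Type*) [NormedAddCommGroup F] [NormedSpace ℝ F] [CompleteSpace F] :
    C(unitInterval, F) →L[ℝ] C(unitInterval, F) :=
  LinearMap.mkContinuous
    { toFun := fun x => ⟨fun t => ∫ s in (0:ℝ)..t, IccExtend zero_le_one x s, by
        have h : Continuous (IccExtend zero_le_one x) := x.continuous.Icc_extend'
        have := intervalIntegral.continuous_primitive (μ := MeasureTheory.volume)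
          (fun a b => h.intervalIntegrable a b) 0
        exact this.comp continuous_subtype_val⟩
      map_add' := fun x y => by
        ext t
        have h : Continuous (IccExtend zero_le_one x) := x.continuous.Icc_extend'
        have h2 : Continuous (IccExtend zero_le_one y) := y.continuous.Icc_extend'
        simp only [ContinuousMap.coe_mk, ContinuousMap.add_apply]
        rw [← intervalIntegral.integral_add (h.intervalIntegrable _ _) (h2.intervalIntegrable _ _)]
        rfl
      map_smul' := fun c x => by
        ext t
        simp only [ContinuousMap.coe_mk, ContinuousMap.smul_apply, RingHom.id_apply]
        rw [← intervalIntegral.integral_smul]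
        rfl } 1 (fun x => by
        rw [ContinuousMap.norm_le _ (by positivity)]
        intro t
        have := intervalIntegral.norm_integral_le_of_norm_le_const (a := 0) (b := (t:ℝ))
          (f := IccExtend zero_le_one x) (C := ‖x‖) (fun s _ => x.norm_coe_le_norm _)
        refine this.trans ?_
        have h0 := t.2.1
        have h1 := t.2.2
        rw [sub_zero, abs_of_nonneg h0, one_mul]
        nlinarith [norm_nonneg x])

lemma Jop_apply [CompleteSpace E] (x : C(unitInterval, E)) (t : unitInterval) :
    Jop E x t = ∫ s in (0:ℝ)..t, IccExtend zero_le_one x s := rfl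

lemma Jop_cst [CompleteSpace E] (c : E) (t : unitInterval) : Jop E (cst E c) t = (t:ℝ) • c := by
  rw [Jop_apply]
  have : (IccExtend zero_le_one (cst E c) : ℝ → E) = fun _ => c := by ext; rfl
  rw [this]; simp

noncomputable def Theta [CompleteSpace E] (B : E →L[ℝ] E →L[ℝ] E) (q : Par E × C(unitInterval, E)) :
    C(unitInterval, E) :=
  q.2 - cst E q.1.2.2.2 - Jop E (q.1.1 • nem B (q.2, q.2) +
    nem (ContinuousLinearMap.id ℝ (E →L[ℝ] E)) (cst _ q.1.2.1, q.2) + cst E q.1.2.2.1)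

lemma Theta_contDiff [CompleteSpace E] (B : E →L[ℝ] E →L[ℝ] E) : ContDiff ℝ 2 (Theta B) := by
  unfold Theta
  have h1 := (nem_bilin B).contDiff (n := 2)
  have h2 := (nem_bilin (ContinuousLinearMap.id ℝ (E →L[ℝ] E))).contDiff (n := 2)
  fun_prop

abbrev XX (E : Type*) [NormedAddCommGroup E] [NormedSpace ℝ E] := Par E × C(unitInterval, E)

noncomputable def prA (E : Type*) [NormedAddCommGroup E] [NormedSpace ℝ E] :
    XX E →L[ℝ] (E →L[ℝ] E) :=
  ContinuousLinearMap.fst ℝ _ _ ∘L ContinuousLinearMap.snd ℝ _ _ ∘L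
          ContinuousLinearMap.fst ℝ (Par E) C(unitInterval, E)
noncomputable def prc (E : Type*) [NormedAddCommGroup E] [NormedSpace ℝ E] :
    XX E →L[ℝ] E :=
  ContinuousLinearMap.fst ℝ _ _ ∘L ContinuousLinearMap.snd ℝ _ _ ∘L ContinuousLinearMap.snd ℝ _ _ ∘L
          ContinuousLinearMap.fst ℝ (Par E) C(unitInterval, E)
noncomputable def prx (E : Type*) [NormedAddCommGroup E] [NormedSpace ℝ E] :
    XX E →L[ℝ] E :=
  ContinuousLinearMap.snd ℝ _ _ ∘L ContinuousLinearMap.snd ℝ _ _ ∘L ContinuousLinearMap.snd ℝ _ _ ∘L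
          ContinuousLinearMap.fst ℝ (Par E) C(unitInterval, E)
noncomputable def pra (E : Type*) [NormedAddCommGroup E] [NormedSpace ℝ E] :
    XX E →L[ℝ] ℝ :=
  ContinuousLinearMap.fst ℝ _ _ ∘L
          ContinuousLinearMap.fst ℝ (Par E) C(unitInterval, E)
noncomputable def pry (E : Type*) [NormedAddCommGroup E] [NormedSpace ℝ E] :
    XX E →L[ℝ] C(unitInterval, E) :=
  ContinuousLinearMap.snd ℝ (Par E) C(unitInterval, E)

@[simp] lemma prA_apply (q : XX E) : prA E q = q.1.2.1 := rfl
@[simp] lemma prc_apply (q : XX E) : prc E q = q.1.2.2.1 := rfl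
@[simp] lemma prx_apply (q : XX E) : prx E q = q.1.2.2.2 := rfl
@[simp] lemma pra_apply (q : XX E) : pra E q = q.1.1 := rfl
@[simp] lemma pry_apply (q : XX E) : pry E q = q.2 := rfl

lemma Theta_deriv [CompleteSpace E] (B : E →L[ℝ] E →L[ℝ] E) (a : ℝ) :
    HasFDerivAt (Theta B)
      (pry E - cst E ∘L prx E - Jop E ∘L cst E ∘L prc E)
      (((a, 0, 0, 0), 0) : XX E) := by
  set u : XX E := ((a, 0, 0, 0), 0) with hu
  have e1 : HasFDerivAt (fun q : XX E => nem B (pry E q, pry E q))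
      (0 : XX E →L[ℝ] _) u := by
    have := HasFDerivAt.comp u ((nem_bilin B).hasFDerivAt (pry E u, pry E u))
      (((pry E).hasFDerivAt (x := u)).prodMk ((pry E).hasFDerivAt (x := u)))
    refine this.congr_fderiv ?_
    refine ContinuousLinearMap.ext fun q => ?_
    ext t
    simp [nem, hu]
  have e2 : HasFDerivAt (fun q : XX E =>
      nem (ContinuousLinearMap.id ℝ (E →L[ℝ] E)) ((cst _ ∘L prA E) q, pry E q))
      (0 : XX E →L[ℝ] _) u := by
    have := HasFDerivAt.comp u ((nem_bilin (ContinuousLinearMap.id ℝ (E →L[ℝ] E))).hasFDerivAt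
      ((cst _ ∘L prA E) u, pry E u))
      (((cst _ ∘L prA E).hasFDerivAt (x := u)).prodMk ((pry E).hasFDerivAt (x := u)))
    refine this.congr_fderiv ?_
    refine ContinuousLinearMap.ext fun q => ?_
    ext t
    simp [nem, hu]
  have e3 := (cst E ∘L prc E).hasFDerivAt (x := u)
  have e4 := ((((pra E).hasFDerivAt (x := u)).smul e1).add e2).add e3
  have hz : nem B (pry E u, pry E u) = 0 := by ext t; simp [nem, hu]
  have e5 := (((pry E).hasFDerivAt (x := u)).sub ((cst E ∘L prx E).hasFDerivAt (x := u))).sub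
    (HasFDerivAt.comp u ((Jop E).hasFDerivAt) e4)
  refine e5.congr_fderiv ?_
  refine ContinuousLinearMap.ext fun q => ?_
  ext t
  rw [hz]; simp

lemma Theta_zero_sol [CompleteSpace E] (B : E →L[ℝ] E →L[ℝ] E) (p : Par E) (x : C(unitInterval, E))
    (h : Theta B (p, x) = 0) :
    ∃ γ : ℝ → E, γ 0 = p.2.2.2 ∧ γ 1 = x 1 ∧ Sol (fld B p) γ := by
  set w : C(unitInterval, E) := p.1 • nem B (x, x) +
    nem (ContinuousLinearMap.id ℝ (E →L[ℝ] E)) (cst _ p.2.1, x) + cst E p.2.2.1 with hw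
  have hx : ∀ t : unitInterval, x t = p.2.2.2 + ∫ s in (0:ℝ)..t, IccExtend zero_le_one w s := by
    intro t
    have := congrArg (fun z : C(unitInterval, E) => z t) h
    simp only [Theta, ContinuousMap.sub_apply, cst_apply, ContinuousMap.zero_apply] at this
    rw [← hw, Jop_apply] at this
    rw [sub_sub, sub_eq_zero] at this
    exact this
  have hc : Continuous (IccExtend zero_le_one w) := w.continuous.Icc_extend'
  refine ⟨fun t => p.2.2.2 + ∫ s in (0:ℝ)..t, IccExtend zero_le_one w s, by simp, ?_, ?_⟩
  · rw [hx 1]; simp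
  · intro t ht
    have h1 : HasDerivAt (fun t => p.2.2.2 + ∫ s in (0:ℝ)..t, IccExtend zero_le_one w s)
        (IccExtend zero_le_one w t) t :=
      (intervalIntegral.integral_hasDerivAt_right (hc.intervalIntegrable _ _)
        hc.aestronglyMeasurable.stronglyMeasurableAtFilter hc.continuousAt).const_add _
    have h2 : IccExtend zero_le_one w t = fld B p (x ⟨t, ht⟩) := by
      rw [IccExtend_of_mem _ _ ht]
      simp [hw, nem, fld]
    have h3 := hx ⟨t, ht⟩
    rw [h2, h3] at h1
    exact h1.hasDerivWithinAt

/-- the local solution operator -/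
theorem germ [CompleteSpace E] (B : E →L[ℝ] E →L[ℝ] E) (a : ℝ) :
    ∃ Φ : Par E → E, ContDiffAt ℝ 2 Φ (a, 0, 0, 0) ∧ Φ (a, 0, 0, 0) = 0 ∧
      (∃ L : Par E →L[ℝ] E, HasFDerivAt Φ L (a, 0, 0, 0) ∧ ∀ q, L q = q.2.2.1 + q.2.2.2) ∧
      ∀ᶠ p in 𝓝 ((a, 0, 0, 0) : Par E), ∃ γ : ℝ → E,
        γ 0 = p.2.2.2 ∧ γ 1 = Φ p ∧ Sol (fld B p) γ := by
  set u : XX E := ((a, 0, 0, 0), 0) with hu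
  have cdf : ContDiffAt ℝ 2 (Theta B) u := (Theta_contDiff B).contDiffAt
  have hd := (Theta_deriv B a).fderiv
  have hinr : fderiv ℝ (Theta B) u ∘L ContinuousLinearMap.inr ℝ (Par E) C(unitInterval, E)
      = ContinuousLinearMap.id ℝ _ := by
    rw [hd]
    refine ContinuousLinearMap.ext fun q => ?_
    ext t
    simp
  have if₂ : (fderiv ℝ (Theta B) u ∘L
      ContinuousLinearMap.inr ℝ (Par E) C(unitInterval, E)).IsInvertible := by
    rw [hinr]
    exact ⟨ContinuousLinearEquiv.refl ℝ _, rfl⟩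
  have pn : (2 : WithTop ℕ∞) ≠ 0 := by norm_num
  set σ := cdf.implicitFunction pn if₂ with hσ
  have s0 : σ (a, 0, 0, 0) = 0 := cdf.implicitFunction_apply_self pn if₂
  have s1 : ContDiffAt ℝ 2 σ (a, 0, 0, 0) := cdf.contDiffAt_implicitFunction pn if₂
  have s2 := (cdf.hasStrictFDerivAt_implicitFunction pn if₂).hasFDerivAt
  have s3 := cdf.eventually_apply_implicitFunction pn if₂
  set ev : C(unitInterval, E) →L[ℝ] E := ContinuousMap.evalCLM ℝ (1 : unitInterval) with hev
  have hΘ0 : Theta B u = 0 := by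
    have : Theta B u = 0 - cst E 0 - Jop E (a • nem B (0,0) +
      nem (ContinuousLinearMap.id ℝ (E →L[ℝ] E)) (cst _ 0, 0) + cst E 0) := rfl
    rw [this, nem_zero_right, nem_zero_right, ContinuousLinearMap.map_zero (cst E)]
    simp
  refine ⟨fun p => ev (σ p), ?_, ?_, ⟨_, ev.hasFDerivAt.comp _ s2, ?_⟩, ?_⟩
  · exact ev.contDiff.contDiffAt.comp _ s1
  · simp [s0]
  · intro q
    rw [hinr, ContinuousLinearMap.inverse_id, hd]
    simp [hev, ContinuousMap.evalCLM, Jop_cst]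
  · filter_upwards [s3] with p hp
    rw [hΘ0] at hp
    obtain ⟨γ, h0, h1, h2⟩ := Theta_zero_sol B p (σ p) hp
    exact ⟨γ, h0, h1, h2⟩

/-- uniqueness -/
theorem Sol.unique {B : E →L[ℝ] E →L[ℝ] E} {p : Par E} {γ₁ γ₂ : ℝ → E}
    (h₁ : Sol (fld B p) γ₁) (h₂ : Sol (fld B p) γ₂) (h0 : γ₁ 0 = γ₂ 0) :
    EqOn γ₁ γ₂ (Icc 0 1) := by
  obtain ⟨R₁, hR₁⟩ := (isCompact_Icc.image_of_continuousOn h₁.continuousOn).isBounded.exists_norm_le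
  obtain ⟨R₂, hR₂⟩ := (isCompact_Icc.image_of_continuousOn h₂.continuousOn).isBounded.exists_norm_le
  set R := max (max R₁ R₂) 0 with hR
  have hR0 : 0 ≤ R := le_max_right _ _
  set K : ℝ := |p.1| * (‖B‖ * (2 * R)) + ‖p.2.1‖ with hK
  have hK0 : 0 ≤ K := by positivity
  have hlip : LipschitzOnWith ⟨K, hK0⟩ (fld B p) {x | ‖x‖ ≤ R} := by
    refine LipschitzOnWith.of_dist_le_mul fun x hx y hy => ?_
    rw [dist_eq_norm, dist_eq_norm]
    have e : fld B p x - fld B p y = p.1 • (B x (x - y) + B (x - y) y) + p.2.1 (x - y) := by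
      simp only [fld, map_sub, _root_.sub_apply, smul_add, smul_sub]
      abel
    rw [e]
    have b1 : ‖B x (x - y)‖ ≤ ‖B‖ * R * ‖x - y‖ := by
      refine (B.le_opNorm₂ _ _).trans ?_
      gcongr
      exact hx
    have b2 : ‖B (x - y) y‖ ≤ ‖B‖ * R * ‖x - y‖ := by
      refine (B.le_opNorm₂ _ _).trans ?_
      rw [mul_assoc, mul_assoc, mul_comm R]
      gcongr
      exact hy
    have b3 : ‖p.2.1 (x - y)‖ ≤ ‖p.2.1‖ * ‖x - y‖ := p.2.1.le_opNorm _
    calc _ ≤ ‖p.1 • (B x (x - y) + B (x - y) y)‖ + ‖p.2.1 (x - y)‖ := norm_add_le _ _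
      _ ≤ |p.1| * (‖B x (x - y)‖ + ‖B (x - y) y‖) + ‖p.2.1 (x - y)‖ := by
        rw [norm_smul, Real.norm_eq_abs]
        gcongr
        exact norm_add_le _ _
      _ ≤ |p.1| * (‖B‖ * R * ‖x - y‖ + ‖B‖ * R * ‖x - y‖) + ‖p.2.1‖ * ‖x - y‖ := by gcongr
      _ = K * ‖x - y‖ := by rw [hK]; ring
  refine ODE_solution_unique_of_mem_Icc_right (v := fun _ => fld B p) (s := fun _ => {x | ‖x‖ ≤ R})
    (K := ⟨K, hK0⟩) (fun t _ => hlip) h₁.continuousOn (fun t ht => ?_) (fun t ht => ?_)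
    h₂.continuousOn (fun t ht => ?_) (fun t ht => ?_) h0
  · exact (h₁ t (Ico_subset_Icc_self ht)).mono_of_mem_nhdsWithin (Icc_mem_nhdsGE_of_mem ht)
  · exact (hR₁ _ ⟨t, Ico_subset_Icc_self ht, rfl⟩).trans ((le_max_left _ _).trans (le_max_left _ _))
  · exact (h₂ t (Ico_subset_Icc_self ht)).mono_of_mem_nhdsWithin (Icc_mem_nhdsGE_of_mem ht)
  · exact (hR₂ _ ⟨t, Ico_subset_Icc_self ht, rfl⟩).trans ((le_max_right _ _).trans (le_max_left _ _))

end germ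
end MRB


namespace MRB
open Filter Topology
section reach
variable {E : Type*} [NormedAddCommGroup E] [NormedSpace ℝ E]

lemma Sol.reverse {f : E → E} {γ : ℝ → E} (h : Sol f γ) :
    Sol (fun z => - f z) (fun t => γ (1 - t)) := by
  intro t ht
  have h1 : (1 - t) ∈ Icc (0:ℝ) 1 := ⟨by linarith [ht.2], by linarith [ht.1]⟩
  have h2 : HasDerivWithinAt (fun t : ℝ => 1 - t) (-1) (Icc 0 1) t := by
    simpa using (hasDerivWithinAt_id t (Icc (0:ℝ) 1)).const_sub 1
  have := (h (1 - t) h1).scomp t h2 (fun s hs => ⟨by linarith [hs.2], by linarith [hs.1]⟩)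
  simpa [Function.comp_def] using this

lemma Sol.const_smul {f : E → E} {γ : ℝ → E} (h : Sol f γ) (ε : ℝ) {g : E → E}
    (hg : ∀ z, g (ε • z) = ε • f z) : Sol g (fun t => ε • γ t) := by
  intro t ht
  rw [hg]
  exact (h t ht).const_smul ε

lemma Sol.add_const {f : E → E} {γ : ℝ → E} (h : Sol f γ) (w : E) {g : E → E}
    (hg : ∀ z, g (w + z) = f z) : Sol g (fun t => w + γ t) := by
  intro t ht
  rw [hg]
  exact (h t ht).const_add w

lemma Sol.sub {f : E → E} {γ : ℝ → E} (h : Sol f γ) {a d : ℝ} (ha : 0 ≤ a) (hd : 0 ≤ d)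
    (had : a + d ≤ 1) : Sol (fun z => d • f z) (fun t => γ (a + d * t)) := by
  intro t ht
  have hm : ∀ s ∈ Icc (0:ℝ) 1, a + d * s ∈ Icc (0:ℝ) 1 := fun s hs =>
    ⟨by have := mul_nonneg hd hs.1; linarith, by nlinarith [hs.1, hs.2]⟩
  have h2 : HasDerivWithinAt (fun t : ℝ => a + d * t) d (Icc 0 1) t := by
    simpa using ((hasDerivWithinAt_id t (Icc (0:ℝ) 1)).const_mul d).const_add a
  exact (h _ (hm t ht)).scomp t h2 hm

/-- the controlled damped field -/
noncomputable def vf (B : E →L[ℝ] E →L[ℝ] E) (ν : ℝ) (c z : E) : E := B z z - ν • z + c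

/-- parameters of the shifted equation -/
noncomputable def PP (B : E →L[ℝ] E →L[ℝ] E) (s ν : ℝ) (c w z₀ : E) : Par E :=
  (s, s • ((2:ℝ) • B w - ν • ContinuousLinearMap.id ℝ E), s • vf B ν c w, z₀)

lemma PP_continuous (B : E →L[ℝ] E →L[ℝ] E) :
    Continuous (fun q : ℝ × ℝ × E × E × E => PP B q.1 q.2.1 q.2.2.1 q.2.2.2.1 q.2.2.2.2) := by
  unfold PP vf
  fun_prop

lemma PP_zero (B : E →L[ℝ] E →L[ℝ] E) (ν : ℝ) (c w : E) : PP B 0 ν c w 0 = (0, 0, 0, 0) := by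
  simp [PP]

lemma fld_PP {B : E →L[ℝ] E →L[ℝ] E} (hB : ∀ x y, B x y = B y x) (s ν : ℝ) (c w z₀ z : E) :
    s • vf B ν c (w + z) = fld B (PP B s ν c w z₀) z := by
  simp only [vf, fld, PP, map_add, _root_.add_apply, _root_.sub_apply, _root_.smul_apply,
    ContinuousLinearMap.id_apply]
  rw [hB z w]
  module

lemma fld_PP0 {B : E →L[ℝ] E →L[ℝ] E} (s ν : ℝ) (c z₀ z : E) :
    s • vf B ν c z = fld B (PP B s ν c 0 z₀) z := by
  simp [vf, fld, PP]
  module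

lemma Sol_vf_unique {B : E →L[ℝ] E →L[ℝ] E} {s ν : ℝ} {c : E} {γ₁ γ₂ : ℝ → E}
    (h₁ : Sol (fun z => s • vf B ν c z) γ₁) (h₂ : Sol (fun z => s • vf B ν c z) γ₂)
    (h0 : γ₁ 0 = γ₂ 0) : EqOn γ₁ γ₂ (Icc 0 1) :=
  Sol.unique (B := B) (p := PP B s ν c 0 0) (h₁.congr fun _ => fld_PP0 _ _ _ _ _)
    (h₂.congr fun _ => fld_PP0 _ _ _ _ _) h0

def Step (B : E →L[ℝ] E →L[ℝ] E) (V : Submodule ℝ E) (ν : ℝ) (x y : E) : Prop :=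
  ∃ T : ℝ, 0 < T ∧ ∃ c ∈ V, ∃ γ : ℝ → E, γ 0 = x ∧ γ 1 = y ∧ Sol (fun z => T • vf B ν c z) γ

def Reach (B : E →L[ℝ] E →L[ℝ] E) (V : Submodule ℝ E) (ν : ℝ) : E → E → Prop :=
  Relation.ReflTransGen (Step B V ν)

lemma Step.neg {B : E →L[ℝ] E →L[ℝ] E} {V : Submodule ℝ E} {ν : ℝ} {x y : E}
    (h : Step B V ν x y) : Step B V (-ν) (-y) (-x) := by
  obtain ⟨T, hT, c, hc, γ, h0, h1, hs⟩ := h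
  refine ⟨T, hT, c, hc, fun t => (-1 : ℝ) • γ (1 - t), by simp [h1], by simp [h0], ?_⟩
  refine hs.reverse.const_smul (-1) fun z => ?_
  simp only [vf, map_smul, _root_.smul_apply]
  module

lemma Step.scale {B : E →L[ℝ] E →L[ℝ] E} {V : Submodule ℝ E} {ν : ℝ} {x y : E} {ε : ℝ} (hε : 0 < ε)
    (h : Step B V ν x y) : Step B V (ε * ν) (ε • x) (ε • y) := by
  obtain ⟨T, hT, c, hc, γ, h0, h1, hs⟩ := h
  refine ⟨T / ε, by positivity, ε ^ 2 • c, V.smul_mem _ hc, fun t => ε • γ t, by simp [h0],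
    by simp [h1], hs.const_smul ε fun z => ?_⟩
  simp only [vf, map_smul, _root_.smul_apply, smul_add, smul_sub, smul_smul]
  have e1 : T / ε * (ε * ε) = ε * T := by field_simp
  have e2 : T / ε * (ε * (ν * ε)) = ε * (T * ν) := by field_simp
  have e3 : T / ε * ε ^ 2 = ε * T := by field_simp
  simp only [e1, e2, e3, mul_assoc]

lemma Reach.neg {B : E →L[ℝ] E →L[ℝ] E} {V : Submodule ℝ E} {ν : ℝ} {x y : E}
    (h : Reach B V ν x y) : Reach B V (-ν) (-y) (-x) := by
  induction h with
  | refl => exact Relation.ReflTransGen.refl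
  | tail _ h2 ih => exact Relation.ReflTransGen.head h2.neg ih

lemma Reach.scale {B : E →L[ℝ] E →L[ℝ] E} {V : Submodule ℝ E} {ν : ℝ} {x y : E} {ε : ℝ} (hε : 0 < ε)
    (h : Reach B V ν x y) : Reach B V (ε * ν) (ε • x) (ε • y) := by
  induction h with
  | refl => exact Relation.ReflTransGen.refl
  | tail _ h2 ih => exact Relation.ReflTransGen.tail ih (h2.scale hε)

/-- robust reachability -/
def Rob (B : E →L[ℝ] E →L[ℝ] E) (V : Submodule ℝ E) (x y : E) : Prop :=
  ∀ᶠ p : ℝ × E × E in 𝓝 (0, x, y), Reach B V p.1 p.2.1 p.2.2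

lemma Rob.trans {B : E →L[ℝ] E →L[ℝ] E} {V : Submodule ℝ E} {x y z : E}
    (h1 : Rob B V x y) (h2 : Rob B V y z) : Rob B V x z := by
  have t1 : Tendsto (fun p : ℝ × E × E => (p.1, p.2.1, y)) (𝓝 (0, x, z)) (𝓝 (0, x, y)) :=
    Continuous.tendsto' (by fun_prop) _ _ rfl
  have t2 : Tendsto (fun p : ℝ × E × E => (p.1, y, p.2.2)) (𝓝 (0, x, z)) (𝓝 (0, y, z)) :=
    Continuous.tendsto' (by fun_prop) _ _ rfl
  filter_upwards [t1.eventually h1, t2.eventually h2] with p a b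
  exact Relation.ReflTransGen.trans a b

lemma Rob.neg {B : E →L[ℝ] E →L[ℝ] E} {V : Submodule ℝ E} {x y : E}
    (h : Rob B V x y) : Rob B V (-y) (-x) := by
  have t1 : Tendsto (fun p : ℝ × E × E => (-p.1, -p.2.2, -p.2.1)) (𝓝 (0, -y, -x)) (𝓝 (0, x, y)) :=
    Continuous.tendsto' (by fun_prop) _ _ (by simp)
  filter_upwards [t1.eventually h] with p a
  simpa using a.neg

lemma Rob.isOpen (B : E →L[ℝ] E →L[ℝ] E) (V : Submodule ℝ E) (x : E) : IsOpen {y | Rob B V x y} := by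
  rw [isOpen_iff_mem_nhds]
  intro y hy
  have h2 := eventually_eventually_nhds.2 (show ∀ᶠ p : ℝ × E × E in 𝓝 (0, x, y), _ from hy)
  have t1 : Tendsto (fun z : E => ((0:ℝ), x, z)) (𝓝 y) (𝓝 (0, x, y)) :=
    Continuous.tendsto' (by fun_prop) _ _ rfl
  exact t1.eventually h2

lemma Rob.global {B : E →L[ℝ] E →L[ℝ] E} {V : Submodule ℝ E} (h : Rob B V 0 0) (ν : ℝ) (x y : E) :
    Reach B V ν x y := by
  have t1 : Tendsto (fun ε : ℝ => (ε * ν, ε • x, ε • y)) (𝓝[>] 0) (𝓝 (0, 0, 0)) :=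
    (Continuous.tendsto' (by fun_prop) _ _ (by simp)).mono_left nhdsWithin_le_nhds
  obtain ⟨ε, h1, h2⟩ := ((t1.eventually h).and self_mem_nhdsWithin).exists
  have h3 : 0 < ε := h2
  have := Reach.scale (inv_pos.2 h3) h1
  simpa [h3.ne', smul_smul] using this

/-- the local flow germ -/
noncomputable def Phi [CompleteSpace E] (B : E →L[ℝ] E →L[ℝ] E) (a : ℝ) : Par E → E :=
  (germ B a).choose

/-- good parameters -/
def Good [CompleteSpace E] (B : E →L[ℝ] E →L[ℝ] E) (a : ℝ) (p : Par E) : Prop :=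
  ContDiffAt ℝ 2 (Phi B a) p ∧ ∃ γ : ℝ → E,
        γ 0 = p.2.2.2 ∧ γ 1 = Phi B a p ∧ Sol (fld B p) γ

lemma Good_ev [CompleteSpace E] (B : E →L[ℝ] E →L[ℝ] E) (a : ℝ) :
    ∀ᶠ p in 𝓝 ((a, 0, 0, 0) : Par E), ∀ᶠ p' in 𝓝 p, Good B a p' := by
  rw [eventually_eventually_nhds]
  have h := (germ B a).choose_spec
  exact (h.1.eventually (by simp)).and h.2.2.2

lemma Good_self [CompleteSpace E] (B : E →L[ℝ] E →L[ℝ] E) (a : ℝ) : Good B a (a, 0, 0, 0) :=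
  (Good_ev B a).self_of_nhds.self_of_nhds

lemma Phi_zero [CompleteSpace E] (B : E →L[ℝ] E →L[ℝ] E) (a : ℝ) : Phi B a (a, 0, 0, 0) = 0 :=
  (germ B a).choose_spec.2.1

lemma Phi_fderiv [CompleteSpace E] (B : E →L[ℝ] E →L[ℝ] E) (a : ℝ) :
    ∃ L : Par E →L[ℝ] E, HasFDerivAt (Phi B a) L (a, 0, 0, 0) ∧ ∀ q, L q = q.2.2.1 + q.2.2.2 :=
  (germ B a).choose_spec.2.2.1

lemma Good.sol [CompleteSpace E] {B : E →L[ℝ] E →L[ℝ] E} (hB : ∀ x y, B x y = B y x) {s ν : ℝ}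
    {c w z₀ : E} {a : ℝ} (h : Good B a (PP B s ν c w z₀)) :
    ∃ γ : ℝ → E, γ 0 = w + z₀ ∧ γ 1 = w + Phi B a (PP B s ν c w z₀) ∧
      Sol (fun z => s • vf B ν c z) γ := by
  obtain ⟨-, γ, h0, h1, hs⟩ := h
  refine ⟨fun t => w + γ t, ?_, ?_, hs.add_const w fun z => fld_PP hB _ _ _ _ _ _⟩
  · simp [h0, PP]
  · simp [h1]

lemma Good.step [CompleteSpace E] {B : E →L[ℝ] E →L[ℝ] E} (hB : ∀ x y, B x y = B y x) {s ν : ℝ}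
    {c w z₀ : E} {a : ℝ} (h : Good B a (PP B s ν c w z₀)) {V : Submodule ℝ E} (hs : 0 < s)
    (hc : c ∈ V) : Step B V ν (w + z₀) (w + Phi B a (PP B s ν c w z₀)) := by
  obtain ⟨γ, h0, h1, h2⟩ := h.sol hB
  exact ⟨s, hs, c, hc, γ, h0, h1, h2⟩

lemma Good.back [CompleteSpace E] {B : E →L[ℝ] E →L[ℝ] E} (hB : ∀ x y, B x y = B y x) {s ν : ℝ}
    {c w z₀ : E} {a : ℝ} (h : Good B a (PP B (-s) ν c w z₀)) {V : Submodule ℝ E} (hs : 0 < s)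
    (hc : c ∈ V) : Step B V ν (w + Phi B a (PP B (-s) ν c w z₀)) (w + z₀) := by
  obtain ⟨γ, h0, h1, h2⟩ := h.sol hB
  exact ⟨s, hs, c, hc, fun t => γ (1 - t), by simp [h1], by simp [h0],
    h2.reverse.congr fun z => by simp⟩

/-- backward continuity of reachability -/
def Bac (B : E →L[ℝ] E →L[ℝ] E) (V : Submodule ℝ E) (y z : E) : Prop :=
  ∀ U ∈ 𝓝 y, ∀ᶠ p : ℝ × E in 𝓝 (0, z), ∃ y' ∈ U, Reach B V p.1 y' p.2

lemma Bac.refl (B : E →L[ℝ] E →L[ℝ] E) (V : Submodule ℝ E) (y : E) : Bac B V y y := by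
  intro U hU
  have t1 : Tendsto (fun p : ℝ × E => p.2) (𝓝 (0, y)) (𝓝 y) :=
    Continuous.tendsto' (by fun_prop) _ _ rfl
  filter_upwards [t1 hU] with p hp
  exact ⟨p.2, hp, Relation.ReflTransGen.refl⟩

lemma Bac.trans {B : E →L[ℝ] E →L[ℝ] E} {V : Submodule ℝ E} {x y z : E} (h1 : Bac B V x y)
    (h2 : Bac B V y z) : Bac B V x z := by
  intro U hU
  obtain ⟨N, hN, U', hU', hh⟩ := mem_nhds_prod_iff.1 (h1 U hU)
  have t1 : Tendsto (fun p : ℝ × E => p.1) (𝓝 (0, z)) (𝓝 0) :=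
    Continuous.tendsto' (by fun_prop) _ _ rfl
  filter_upwards [t1 hN, h2 U' hU'] with p hp ⟨y', hy', hr⟩
  obtain ⟨x', hx', hr'⟩ := hh (show (p.1, y') ∈ N ×ˢ U' from ⟨hp, hy'⟩)
  exact ⟨x', hx', hr'.trans hr⟩

lemma Rob.bac {B : E →L[ℝ] E →L[ℝ] E} {V : Submodule ℝ E} {x y z : E} (h1 : Rob B V x y)
    (h2 : Bac B V y z) : Rob B V x z := by
  have h1' : ∀ᶠ p : ℝ × E × E in 𝓝 (0, x, y), Reach B V p.1 p.2.1 p.2.2 := h1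
  obtain ⟨N, hN, M, hM, hh⟩ := mem_nhds_prod_iff.1 h1'
  obtain ⟨X, hX, Y, hY, hh'⟩ := mem_nhds_prod_iff.1 hM
  have t1 : Tendsto (fun p : ℝ × E × E => p.1) (𝓝 (0, x, z)) (𝓝 0) :=
    Continuous.tendsto' (by fun_prop) _ _ rfl
  have t2 : Tendsto (fun p : ℝ × E × E => p.2.1) (𝓝 (0, x, z)) (𝓝 x) :=
    Continuous.tendsto' (by fun_prop) _ _ rfl
  have t3 : Tendsto (fun p : ℝ × E × E => (p.1, p.2.2)) (𝓝 (0, x, z)) (𝓝 (0, z)) :=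
    Continuous.tendsto' (by fun_prop) _ _ rfl
  filter_upwards [t1 hN, t2 hX, t3.eventually (h2 Y hY)] with p hp hx ⟨y', hy', hr⟩
  have := hh (show (p.1, p.2.1, y') ∈ N ×ˢ M from ⟨hp, hh' ⟨hx, hy'⟩⟩)
  exact Relation.ReflTransGen.trans this hr

lemma Step.bac [CompleteSpace E] {B : E →L[ℝ] E →L[ℝ] E} (hB : ∀ x y, B x y = B y x)
    {V : Submodule ℝ E} {y z : E} (h : Step B V 0 y z) : Bac B V y z := by
  obtain ⟨T, hT, c, hc, γ, h0, h1, hs⟩ := h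
  have hK : IsCompact (γ '' Icc 0 1) := isCompact_Icc.image_of_continuousOn hs.continuousOn
  have hev : ∀ᶠ s : ℝ in 𝓝 0, ∀ w ∈ γ '' Icc 0 1, ∀ᶠ p in 𝓝 (PP B s 0 c w 0), Good B 0 p := by
    refine hK.eventually_forall_of_forall_eventually fun w hw => ?_
    have t : Tendsto (fun q : ℝ × E => PP B q.1 0 c q.2 0) (𝓝 0 ×ˢ 𝓝 w) (𝓝 (0,0,0,0)) := by
      rw [← nhds_prod_eq]
      refine Continuous.tendsto' ?_ _ _ (PP_zero B 0 c w)
      exact (PP_continuous B).comp (f := fun q : ℝ × E => (q.1, (0:ℝ), c, q.2, (0:E))) (by fun_prop)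
    have := t.eventually (Good_ev B 0)
    rw [← nhds_prod_eq]  at this
    exact this
  have tm : Tendsto (fun m : ℕ => -(T / ((m:ℝ) + 1))) atTop (𝓝 0) := by
    have := (tendsto_const_div_atTop_nhds_zero_nat T).comp (tendsto_add_atTop_nat 1)
    simpa [Function.comp_def] using this.neg
  obtain ⟨m, hm⟩ := (tm.eventually hev).exists
  set d : ℝ := 1 / ((m:ℝ) + 1) with hd
  have hd0 : 0 < d := by positivity
  have key : ∀ k : ℕ, k ≤ m + 1 → Bac B V (γ 0) (γ (d * k)) := by
    intro k
    induction k with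
    | zero => intro _; simpa using Bac.refl B V (γ 0)
    | succ k ih =>
      intro hk
      refine (ih (by omega)).trans ?_
      have hk' : d * k + d ≤ 1 := by
        have : (k:ℝ) + 1 ≤ m + 1 := by exact_mod_cast hk
        rw [hd]; field_simp; linarith
      have hseg := hs.sub (a := d * k) (d := d) (by positivity) hd0.le hk'
      set zs := γ (d * (k+1 : ℕ)) with hzs
      have hzs' : γ (d * k + d) = zs := by rw [hzs]; push_cast; ring_nf
      have hmem : zs ∈ γ '' Icc 0 1 := ⟨_, ⟨by positivity, by push_cast; linarith⟩, rfl⟩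
      have hg := hm zs hmem
      have hTd : T / ((m:ℝ) + 1) = d * T := by rw [hd]; ring
      rw [hTd] at hg
      -- value at the base point
      have hrev : Sol (fun z => (-(d * T)) • vf B 0 c z) (fun t => γ (d * k + d * (1 - t))) :=
        hseg.reverse.congr fun z => by rw [smul_smul, neg_smul]
      obtain ⟨β, b0, b1, bs⟩ := (hg.self_of_nhds).sol hB
      have hval : zs + Phi B 0 (PP B (-(d * T)) 0 c zs 0) = γ (d * k) := by
        have := Sol_vf_unique bs hrev (by simp [b0, hzs']) (show (1:ℝ) ∈ Icc (0:ℝ) 1 by simp)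
        rw [← b1, this]; simp
      intro U hU
      have hP : Continuous (fun p : ℝ × E => PP B (-(d * T)) p.1 c zs (p.2 - zs)) :=
        (PP_continuous B).comp (f := fun p : ℝ × E => (-(d * T), p.1, c, zs, p.2 - zs)) (by fun_prop)
      have hP0 : Tendsto (fun p : ℝ × E => PP B (-(d * T)) p.1 c zs (p.2 - zs)) (𝓝 (0, zs))
          (𝓝 (PP B (-(d * T)) 0 c zs 0)) := hP.tendsto' _ _ (by simp)
      have hlim : Tendsto (fun p : ℝ × E => zs + Phi B 0 (PP B (-(d * T)) p.1 c zs (p.2 - zs)))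
          (𝓝 (0, zs)) (𝓝 (γ (d * k))) := by
        rw [← hval]
        exact ((hg.self_of_nhds.1.continuousAt.tendsto.comp hP0)).const_add zs
      filter_upwards [hlim hU, hP0.eventually hg] with p hp1 hp2
      refine ⟨_, hp1, Relation.ReflTransGen.single ?_⟩
      have := hp2.back hB (s := d * T) (by positivity) hc
      simpa using this
  have := key (m + 1) le_rfl
  have hd1 : d * ((m + 1 : ℕ) : ℝ) = 1 := by rw [hd]; push_cast; field_simp
  rw [hd1, h0, h1] at this
  exact this

lemma Rob.step [CompleteSpace E] {B : E →L[ℝ] E →L[ℝ] E} (hB : ∀ x y, B x y = B y x)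
    {V : Submodule ℝ E} {x y z : E} (h1 : Rob B V x y) (h : Step B V 0 y z) : Rob B V x z :=
  h1.bac (h.bac hB)

end reach
end MRB


namespace MRB
open Filter Topology
section krener
variable {E : Type*} [NormedAddCommGroup E] [NormedSpace ℝ E] [FiniteDimensional ℝ E]
variable {P : Type*} [NormedAddCommGroup P] [NormedSpace ℝ P] [FiniteDimensional ℝ P]

lemma coord_field {G : P → E} {t₀ : P} (hG : ContDiffAt ℝ 2 G t₀)
    (hi : Function.Injective (fderiv ℝ G t₀)) {X : E → E} (hX : Differentiable ℝ X)
    (hXr : ∀ᶠ t in 𝓝 t₀, X (G t) ∈ LinearMap.range (fderiv ℝ G t).toLinearMap) :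
    ∃ a : P → P, DifferentiableAt ℝ a t₀ ∧ ∀ᶠ t in 𝓝 t₀, X (G t) = fderiv ℝ G t (a t) := by
  have : CompleteSpace E := FiniteDimensional.complete ℝ E
  have : CompleteSpace P := FiniteDimensional.complete ℝ P
  obtain ⟨g, hg⟩ := LinearMap.exists_leftInverse_of_injective (fderiv ℝ G t₀).toLinearMap
    (LinearMap.ker_eq_bot.2 hi)
  set L : E →L[ℝ] P := LinearMap.toContinuousLinearMap g with hL
  have hL1 : L ∘L fderiv ℝ G t₀ = ContinuousLinearMap.id ℝ P := by
    ext x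
    exact congrArg (fun f : P →ₗ[ℝ] P => f x) hg
  have hDG : ContDiffAt ℝ 1 (fderiv ℝ G) t₀ := hG.fderiv_right (by norm_num)
  have hM : ContDiffAt ℝ 1 (fun t => L ∘L fderiv ℝ G t) t₀ := contDiffAt_const.clm_comp hDG
  have hinv : ContDiffAt ℝ 1 (fun t => ContinuousLinearMap.inverse (L ∘L fderiv ℝ G t)) t₀ := by
    have h0 : ContDiffAt ℝ 1 (ContinuousLinearMap.inverse : (P →L[ℝ] P) → (P →L[ℝ] P))
        (L ∘L fderiv ℝ G t₀) := by
      rw [hL1]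
      exact contDiffAt_map_inverse (ContinuousLinearEquiv.refl ℝ P)
    exact h0.comp t₀ hM
  have hdG : DifferentiableAt ℝ G t₀ := hG.differentiableAt (by norm_num)
  refine ⟨fun t => ContinuousLinearMap.inverse (L ∘L fderiv ℝ G t) (L (X (G t))), ?_, ?_⟩
  · refine (hinv.differentiableAt (by norm_num)).clm_apply ?_
    exact L.differentiableAt.comp t₀ ((hX _).comp t₀ hdG)
  · have hn : ∀ᶠ t in 𝓝 t₀, (L ∘L fderiv ℝ G t).IsInvertible := by
      have h1 : range ((↑) : (P ≃L[ℝ] P) → P →L[ℝ] P) ∈ 𝓝 (L ∘L fderiv ℝ G t₀) := by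
        rw [hL1]
        exact ContinuousLinearEquiv.nhds (ContinuousLinearEquiv.refl ℝ P)
      exact hM.continuousAt h1
    filter_upwards [hn, hXr] with t ht ⟨b, hb⟩
    have hb' : fderiv ℝ G t b = X (G t) := hb
    obtain ⟨e, he⟩ := ht
    have h2 : L (X (G t)) = (L ∘L fderiv ℝ G t) b := by simp [hb']
    rw [h2, ← he, ContinuousLinearMap.inverse_equiv]
    simp [hb']

lemma bracket_range {G : P → E} {t₀ : P} (hG : ContDiffAt ℝ 2 G t₀)
    (hi : Function.Injective (fderiv ℝ G t₀)) {X Y : E → E} (hX : Differentiable ℝ X)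
    (hY : Differentiable ℝ Y)
    (hXr : ∀ᶠ t in 𝓝 t₀, X (G t) ∈ LinearMap.range (fderiv ℝ G t).toLinearMap)
    (hYr : ∀ᶠ t in 𝓝 t₀, Y (G t) ∈ LinearMap.range (fderiv ℝ G t).toLinearMap) :
    fderiv ℝ X (G t₀) (Y (G t₀)) - fderiv ℝ Y (G t₀) (X (G t₀)) ∈
      LinearMap.range (fderiv ℝ G t₀).toLinearMap := by
  obtain ⟨a, ha, hae⟩ := coord_field hG hi hX hXr
  obtain ⟨b, hb, hbe⟩ := coord_field hG hi hY hYr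
  have hdG : DifferentiableAt ℝ G t₀ := hG.differentiableAt (by norm_num)
  have hDG : DifferentiableAt ℝ (fderiv ℝ G) t₀ :=
    (hG.fderiv_right (m := 1) (by norm_num)).differentiableAt (by norm_num)
  have key : ∀ {X : E → E} {a : P → P}, Differentiable ℝ X → DifferentiableAt ℝ a t₀ →
      (∀ᶠ t in 𝓝 t₀, X (G t) = fderiv ℝ G t (a t)) → ∀ v,
      fderiv ℝ X (G t₀) (fderiv ℝ G t₀ v) =
        fderiv ℝ (fderiv ℝ G) t₀ v (a t₀) + fderiv ℝ G t₀ (fderiv ℝ a t₀ v) := by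
    intro X a hX ha hae v
    have h1 := (hX (G t₀)).hasFDerivAt.comp t₀ hdG.hasFDerivAt
    have h2 := hDG.hasFDerivAt.clm_apply ha.hasFDerivAt
    have h3 := h1.unique (h2.congr_of_eventuallyEq hae)
    have := congrArg (fun f : P →L[ℝ] E => f v) h3
    simp at this
    rw [this]; abel
  have k1 := key hX ha hae (b t₀)
  have k2 := key hY hb hbe (a t₀)
  have hsym := (hG.isSymmSndFDerivAt (by simp)) (b t₀) (a t₀)
  rw [hbe.self_of_nhds, hae.self_of_nhds, k1, k2, hsym]
  refine ⟨fderiv ℝ a t₀ (b t₀) - fderiv ℝ b t₀ (a t₀), ?_⟩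
  simp

/-- If every admissible field is tangent to an immersed piece then the piece is open. -/
lemma tangent_surj {B : E →L[ℝ] E →L[ℝ] E} (hB : ∀ x y, B x y = B y x) {V : Submodule ℝ E}
    (hgen : ∀ W : Submodule ℝ E, V ≤ W → (∀ x ∈ W, ∀ y ∈ W, B x y ∈ W) → W = ⊤)
    {G : P → E} {t₀ : P} (hG : ContDiffAt ℝ 2 G t₀)
    (hi : Function.Injective (fderiv ℝ G t₀))
    (htan : ∀ c ∈ V, ∀ᶠ t in 𝓝 t₀, vf B 0 c (G t) ∈ LinearMap.range (fderiv ℝ G t).toLinearMap) :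
    Function.Surjective (fderiv ℝ G t₀) := by
  have hG' : ∀ᶠ t in 𝓝 t₀, ContDiffAt ℝ 2 G t := hG.eventually (by simp)
  have hi' : ∀ᶠ t in 𝓝 t₀, Function.Injective (fderiv ℝ G t) := by
    have hDG : ContDiffAt ℝ 1 (fderiv ℝ G) t₀ := hG.fderiv_right (by norm_num)
    exact hDG.continuousAt (ContinuousLinearMap.isOpen_injective.mem_nhds hi)
  have br : ∀ {X Y : E → E}, Differentiable ℝ X → Differentiable ℝ Y →
      (∀ᶠ t in 𝓝 t₀, X (G t) ∈ LinearMap.range (fderiv ℝ G t).toLinearMap) →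
      (∀ᶠ t in 𝓝 t₀, Y (G t) ∈ LinearMap.range (fderiv ℝ G t).toLinearMap) →
      ∀ᶠ t in 𝓝 t₀, fderiv ℝ X (G t) (Y (G t)) - fderiv ℝ Y (G t) (X (G t)) ∈
      LinearMap.range (fderiv ℝ G t).toLinearMap := by
    intro X Y hX hY hXr hYr
    filter_upwards [hG', hi', eventually_eventually_nhds.2 hXr, eventually_eventually_nhds.2 hYr]
      with t h1 h2 h3 h4
    exact bracket_range h1 h2 hX hY h3 h4
  let W : Submodule ℝ E :=
    { carrier := {w | ∀ᶠ t in 𝓝 t₀, w ∈ LinearMap.range (fderiv ℝ G t).toLinearMap}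
      add_mem' := fun h1 h2 => by
        filter_upwards [h1, h2] with t a b using Submodule.add_mem _ a b
      zero_mem' := Eventually.of_forall fun t => Submodule.zero_mem _
      smul_mem' := fun r w h => by
        filter_upwards [h] with t a using Submodule.smul_mem _ r a }
  have hF : ∀ᶠ t in 𝓝 t₀, B (G t) (G t) ∈ LinearMap.range (fderiv ℝ G t).toLinearMap := by
    filter_upwards [htan 0 V.zero_mem] with t ht
    simpa [vf] using ht
  have hFd : ∀ x, HasFDerivAt (fun z => B z z) ((2:ℝ) • B x) x := by
    intro x
    have := B.hasFDerivAt.clm_apply (hasFDerivAt_id x) (x := x)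
    refine this.congr_fderiv ?_
    ext v
    simp [hB v x, two_smul]
  have hVW : V ≤ W := by
    intro c hc
    show ∀ᶠ t in 𝓝 t₀, _
    filter_upwards [htan c hc, hF] with t h1 h2
    have := Submodule.sub_mem _ h1 h2
    simpa [vf] using this
  have hBW : ∀ x ∈ W, ∀ y ∈ W, B x y ∈ W := by
    intro x hx y hy
    have s1 := br (X := fun z => B z z) (Y := fun _ => x) (fun z => (hFd z).differentiableAt)
      (differentiable_const _) hF hx
    have s2 : ∀ᶠ t in 𝓝 t₀, B x (G t) ∈ LinearMap.range (fderiv ℝ G t).toLinearMap := by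
      filter_upwards [s1] with t ht
      rw [(hFd _).fderiv] at ht
      have := Submodule.smul_mem _ (2⁻¹:ℝ) ht
      simpa [hB x] using this
    have s3 := br (X := fun z => B x z) (Y := fun _ => y) (B x).differentiable
      (differentiable_const _) s2 hy
    show ∀ᶠ t in 𝓝 t₀, _
    filter_upwards [s3] with t ht
    have e : fderiv ℝ (fun z => B x z) (G t) = B x := (B x).fderiv
    rw [e] at ht
    simpa using ht
  have hW := hgen W hVW hBW
  intro w
  have : w ∈ W := by rw [hW]; trivial
  exact (show ∀ᶠ t in 𝓝 t₀, _ from this).self_of_nhds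

/-- reachable immersed families of dimension `k` -/
def Fam (B : E →L[ℝ] E →L[ℝ] E) (V : Submodule ℝ E) (k : ℕ) : Prop :=
  ∃ (P : Type) (_ : NormedAddCommGroup P) (_ : NormedSpace ℝ P) (_ : FiniteDimensional ℝ P)
    (Ψ : ℝ × E × P → E) (t₀ : P), Module.finrank ℝ P = k ∧ ContDiffAt ℝ 2 Ψ (0, 0, t₀) ∧
    (∀ᶠ q in 𝓝 ((0, 0, t₀) : ℝ × E × P), Reach B V q.1 q.2.1 (Ψ q)) ∧
    Function.Injective (fderiv ℝ (fun t => Ψ (0, 0, t)) t₀)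

lemma Fam.zero (B : E →L[ℝ] E →L[ℝ] E) (V : Submodule ℝ E) : Fam B V 0 := by
  refine ⟨Fin 0 → ℝ, inferInstance, inferInstance, inferInstance, fun q => q.2.1, 0, by simp,
    by fun_prop, Eventually.of_forall fun q => Relation.ReflTransGen.refl, ?_⟩
  intro x y _
  exact Subsingleton.elim _ _

lemma Fam.succ {B : E →L[ℝ] E →L[ℝ] E} (hB : ∀ x y, B x y = B y x) {V : Submodule ℝ E}
    (hgen : ∀ W : Submodule ℝ E, V ≤ W → (∀ x ∈ W, ∀ y ∈ W, B x y ∈ W) → W = ⊤)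
    {k : ℕ} (hk : k < Module.finrank ℝ E) (h : Fam B V k) : Fam B V (k + 1) := by
  have : CompleteSpace E := FiniteDimensional.complete ℝ E
  obtain ⟨P, i1, i2, i3, Ψ, t₀, hdim, hΨ, hR, hi⟩ := h
  by_contra hcon
  set G : P → E := fun t => Ψ (0, 0, t) with hGdef
  have hin : ∀ t : P, Tendsto (fun t : P => ((0, 0, t) : ℝ × E × P)) (𝓝 t) (𝓝 (0, 0, t)) :=
    fun t => Continuous.tendsto' (by fun_prop) _ _ rfl
  have hGc : ∀ {t : P}, ContDiffAt ℝ 2 Ψ (0, 0, t) → ContDiffAt ℝ 2 G t := by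
    intro t ht
    exact ht.comp t (by fun_prop : ContDiffAt ℝ 2 (fun t : P => ((0, 0, t) : ℝ × E × P)) t)
  have hG : ContDiffAt ℝ 2 G t₀ := hGc hΨ
  have hi' : ∀ᶠ t in 𝓝 t₀, Function.Injective (fderiv ℝ G t) := by
    have hDG : ContDiffAt ℝ 1 (fderiv ℝ G) t₀ := hG.fderiv_right (by norm_num)
    exact hDG.continuousAt (ContinuousLinearMap.isOpen_injective.mem_nhds hi)
  have htan : ∀ c ∈ V, ∀ᶠ t in 𝓝 t₀,
      vf B 0 c (G t) ∈ LinearMap.range (fderiv ℝ G t).toLinearMap := by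
    intro c hc
    filter_upwards [hi', (hin t₀).eventually (hΨ.eventually (by simp)),
      (hin t₀).eventually (eventually_eventually_nhds.2 hR)] with t h1 h2 h3
    by_contra hnot
    apply hcon
    set w := G t with hw
    set PR : ℝ × E × P × ℝ → Par E :=
      fun q => PP B q.2.2.2 q.1 c w (Ψ (q.1, q.2.1, q.2.2.1) - w) with hPR
    set Ψ' : ℝ × E × P × ℝ → E := fun q => w + Phi B 0 (PR q) with hΨ'
    have hPRc : ContDiffAt ℝ 2 PR (0, 0, t, 0) := by
      have e : ContDiffAt ℝ 2 (fun q : ℝ × E × P × ℝ => Ψ (q.1, q.2.1, q.2.2.1)) (0, 0, t, 0) :=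
        ContDiffAt.comp (g := Ψ) (f := fun q : ℝ × E × P × ℝ => (q.1, q.2.1, q.2.2.1)) _ h2
          (by fun_prop)
      simp only [hPR, PP, vf]
      fun_prop
    have hPR0 : PR (0, 0, t, 0) = (0, 0, 0, 0) := by
      simp [hPR, PP, hw, hGdef]
    have hΨ'c : ContDiffAt ℝ 2 Ψ' (0, 0, t, 0) := by
      refine contDiffAt_const.add ?_
      refine ContDiffAt.comp (g := Phi B 0) _ ?_ hPRc
      rw [hPR0]
      exact (Good_self B 0).1
    -- derivative of the extended family
    set G' : P × ℝ → E := fun r => Ψ' (0, 0, r) with hG'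
    have hin' : ∀ r : P × ℝ, Tendsto (fun r : P × ℝ => ((0, 0, r) : ℝ × E × P × ℝ)) (𝓝 r)
      (𝓝 (0, 0, r)) := fun r => Continuous.tendsto' (by fun_prop) _ _ rfl
    have hG'c : ContDiffAt ℝ 2 G' (t, 0) :=
      ContDiffAt.comp (g := Ψ') (f := fun r : P × ℝ => ((0, 0, r) : ℝ × E × P × ℝ)) (t, 0) hΨ'c
        (by fun_prop)
    obtain ⟨L, hL, hL'⟩ := Phi_fderiv B 0
    have hGt : HasFDerivAt G (fderiv ℝ G t) t :=
      ((hGc h2).differentiableAt (by norm_num)).hasFDerivAt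
    have hd : ∀ v : P × ℝ, fderiv ℝ G' (t, 0) v = v.2 • vf B 0 c w + fderiv ℝ G t v.1 := by
      set PR' : P × ℝ → Par E := fun r => PP B r.2 0 c w (G r.1 - w) with hPR'
      have d2 : HasFDerivAt (fun r : P × ℝ => r.2) (ContinuousLinearMap.snd ℝ P ℝ) (t, 0) :=
        hasFDerivAt_snd
      have d1 : HasFDerivAt (fun r : P × ℝ => G r.1) (fderiv ℝ G t ∘L ContinuousLinearMap.fst ℝ P ℝ)
          (t, 0) := HasFDerivAt.comp (g := G) (t, (0:ℝ)) hGt hasFDerivAt_fst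
      have hdd := d2.prodMk ((d2.smul_const ((2:ℝ) • B w - (0:ℝ) • ContinuousLinearMap.id ℝ E)).prodMk
        ((d2.smul_const (vf B 0 c w)).prodMk (d1.sub_const w)))
      have hL2 : HasFDerivAt (Phi B 0) L (PR' (t, 0)) := by
        have : PR' (t, 0) = (0, 0, 0, 0) := by simp [hPR', PP, hw]
        rw [this]; exact hL
      have hcomp := (HasFDerivAt.comp (t, (0:ℝ)) hL2 hdd).const_add w
      have : fderiv ℝ G' (t, 0) = _ := hcomp.fderiv
      intro v
      rw [this]
      simp [hL']
    have hinj0 : Function.Injective (fderiv ℝ G' (t, 0)) := by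
      rw [injective_iff_map_eq_zero]
      rintro ⟨v, s⟩ hv
      rw [hd] at hv
      have hs : s = 0 := by
        by_contra hs
        apply hnot
        refine ⟨(-s⁻¹) • v, ?_⟩
        have e : fderiv ℝ G t v = - (s • vf B 0 c w) := by
          rw [eq_neg_iff_add_eq_zero, add_comm]; exact hv
        simp [e, smul_smul, hs]
      subst hs
      have : fderiv ℝ G t v = 0 := by simpa using hv
      have := (injective_iff_map_eq_zero _).1 h1 v this
      simp [this]
    have hinj : ∀ᶠ r in 𝓝 (t, (0:ℝ)), Function.Injective (fderiv ℝ G' r) := by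
      have hDG : ContDiffAt ℝ 1 (fderiv ℝ G') (t, 0) := hG'c.fderiv_right (by norm_num)
      exact hDG.continuousAt (ContinuousLinearMap.isOpen_injective.mem_nhds hinj0)
    have hgood : ∀ᶠ q in 𝓝 ((0, 0, t, 0) : ℝ × E × P × ℝ), Good B 0 (PR q) := by
      have tt := hPRc.continuousAt.tendsto
      rw [hPR0] at tt
      exact tt.eventually (Good_ev B 0).self_of_nhds
    have hre : ∀ᶠ q in 𝓝 ((0, 0, t, 0) : ℝ × E × P × ℝ),
        Reach B V q.1 q.2.1 (Ψ (q.1, q.2.1, q.2.2.1)) := by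
      have tt : Tendsto (fun q : ℝ × E × P × ℝ => (q.1, q.2.1, q.2.2.1)) (𝓝 (0, 0, t, 0))
        (𝓝 (0, 0, t)) := Continuous.tendsto' (by fun_prop) _ _ rfl
      exact tt.eventually h3
    have hall := ((hin' (t, 0)).eventually (eventually_eventually_nhds.2 (hgood.and hre))).and
      (((hin' (t, 0)).eventually (hΨ'c.eventually (by simp))).and hinj)
    have hs : Tendsto (fun s : ℝ => (t, s)) (𝓝[>] 0) (𝓝 (t, (0:ℝ))) :=
      (Continuous.tendsto' (by fun_prop) _ _ rfl).mono_left nhdsWithin_le_nhds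
    obtain ⟨s, ⟨g1, g2, g3⟩, g4⟩ := ((hs.eventually hall).and self_mem_nhdsWithin).exists
    have g4 : 0 < s := g4
    refine ⟨P × ℝ, inferInstance, inferInstance, inferInstance, Ψ', (t, s), ?_, g2, ?_, g3⟩
    · rw [Module.finrank_prod, hdim]; simp
    · have hpos : ∀ᶠ q in 𝓝 ((0, 0, t, s) : ℝ × E × P × ℝ), 0 < q.2.2.2 := by
        have tt : Tendsto (fun q : ℝ × E × P × ℝ => q.2.2.2) (𝓝 (0, 0, t, s)) (𝓝 s) :=
          Continuous.tendsto' (by fun_prop) _ _ rfl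
        exact tt.eventually (lt_mem_nhds g4)
      filter_upwards [g1, hpos] with q ⟨q1, q2⟩ q3
      refine Relation.ReflTransGen.tail q2 ?_
      have := q1.step hB q3 hc
      simpa [hΨ'] using this
  have hsurj := tangent_surj hB hgen hG hi htan
  have := LinearMap.finrank_le_finrank_of_injective (f := (fderiv ℝ G t₀).toLinearMap) hi
  have h2 := LinearMap.finrank_range_le (fderiv ℝ G t₀).toLinearMap
  rw [LinearMap.range_eq_top.2 hsurj, finrank_top] at h2
  omega

theorem exists_Rob {B : E →L[ℝ] E →L[ℝ] E} (hB : ∀ x y, B x y = B y x) {V : Submodule ℝ E}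
    (hgen : ∀ W : Submodule ℝ E, V ≤ W → (∀ x ∈ W, ∀ y ∈ W, B x y ∈ W) → W = ⊤) :
    ∃ y, Rob B V 0 y := by
  have : CompleteSpace E := FiniteDimensional.complete ℝ E
  have hk : ∀ k, k ≤ Module.finrank ℝ E → Fam B V k := by
    intro k
    induction k with
    | zero => intro _; exact Fam.zero B V
    | succ k ih => intro h; exact Fam.succ hB hgen (by omega) (ih (by omega))
  obtain ⟨P, i1, i2, i3, Ψ, t₀, hdim, hΨ, hR, hi⟩ := hk _ le_rfl
  have : CompleteSpace P := FiniteDimensional.complete ℝ P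
  set G : P → E := fun t => Ψ (0, 0, t) with hGdef
  have hst := hΨ.hasStrictFDerivAt (by norm_num)
  set DΨ := fderiv ℝ Ψ (0, 0, t₀) with hDΨ
  have hDG : ∀ v, fderiv ℝ G t₀ v = DΨ (0, 0, v) := by
    intro v
    have h1 : HasFDerivAt (fun t : P => ((0, 0, t) : ℝ × E × P))
        ((0 : P →L[ℝ] ℝ).prod ((0 : P →L[ℝ] E).prod (ContinuousLinearMap.id ℝ P))) t₀ :=
      (hasFDerivAt_const _ _).prodMk ((hasFDerivAt_const _ _).prodMk (hasFDerivAt_id _))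
    have h2 : HasFDerivAt G _ t₀ := HasFDerivAt.comp t₀ hst.hasFDerivAt h1
    rw [h2.fderiv]; rfl
  have hsurj : Function.Surjective (fderiv ℝ G t₀) :=
    (LinearMap.injective_iff_surjective_of_finrank_eq_finrank (f := (fderiv ℝ G t₀).toLinearMap)
      hdim).1 hi
  have hH : HasStrictFDerivAt (fun q : ℝ × E × P => (q.1, q.2.1, Ψ q))
      ((ContinuousLinearMap.fst ℝ ℝ (E × P)).prod
        ((ContinuousLinearMap.fst ℝ E P ∘L ContinuousLinearMap.snd ℝ ℝ (E × P)).prod DΨ))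
      (0, 0, t₀) := by
    refine hasStrictFDerivAt_fst.prodMk (HasStrictFDerivAt.prodMk ?_ hst)
    exact (ContinuousLinearMap.fst ℝ E P ∘L ContinuousLinearMap.snd ℝ ℝ (E × P)).hasStrictFDerivAt
  have hmap := hH.map_nhds_eq_of_surj (by
    rw [LinearMap.range_eq_top]
    rintro ⟨a, b, e⟩
    obtain ⟨v, hv⟩ := hsurj (e - DΨ (a, b, 0))
    rw [hDG] at hv
    refine ⟨(a, b, v), ?_⟩
    have : DΨ (a, b, v) = DΨ (0, 0, v) + DΨ (a, b, 0) := by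
      rw [← map_add]; simp
    simp [this, hv])
  refine ⟨Ψ (0, 0, t₀), ?_⟩
  unfold Rob
  rw [← hmap, eventually_map]
  exact hR

end krener
end MRB


namespace MRB
open Filter Topology

lemma det_deriv {m : Type*} [Fintype m] [DecidableEq m] {M : ℝ → Matrix m m ℝ} {N : Matrix m m ℝ}
    {t : ℝ} (h : ∀ i j, HasDerivAt (fun s => M s i j) ((N * M t) i j) t) :
    HasDerivAt (fun s => (M s).det) (N.trace * (M t).det) t := by
  have hd : Differentiable ℝ (fun A : m → m → ℝ => (Matrix.of A).det) := by
    simp only [Matrix.det_apply]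
    simp only [Matrix.of_apply]
    fun_prop
  have h' : HasDerivAt (fun s => (fun i j => M s i j : m → m → ℝ)) (fun i j => (N * M t) i j) t :=
    hasDerivAt_pi.2 fun i => hasDerivAt_pi.2 fun j => h i j
  have h1 := (hd (fun i j => M t i j)).hasFDerivAt.comp_hasDerivAt t h'
  have hl : HasDerivAt (fun s : ℝ => (fun i j => (M t + s • (N * M t)) i j : m → m → ℝ))
      (fun i j => (N * M t) i j) 0 := by
    refine hasDerivAt_pi.2 fun i => hasDerivAt_pi.2 fun j => ?_
    simpa using ((hasDerivAt_id (0:ℝ)).mul_const ((N * M t) i j)).const_add (M t i j)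
  have h2 := HasFDerivAt.comp_hasDerivAt_of_eq (0:ℝ) (hd (fun i j => M t i j)).hasFDerivAt hl
    (by funext i j; simp)
  have h3 : HasDerivAt (fun s : ℝ => (M t + s • (N * M t)).det) (N.trace * (M t).det) 0 := by
    have e : (fun s : ℝ => (M t + s • (N * M t)).det) = fun s : ℝ => (1 + s • N).det * (M t).det := by
      funext s
      rw [← Matrix.det_mul, add_mul, one_mul, Matrix.smul_mul]
    rw [e]
    refine HasDerivAt.mul_const ?_ _
    have e2 : (fun s : ℝ => (1 + s • N).det) = fun s : ℝ => 1 + N.trace * s +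
      (Polynomial.aeval s (Matrix.det (1 + (Polynomial.X : Polynomial ℝ) • N.map Polynomial.C)).divX.divX) * s ^ 2 := by
      funext s
      rw [Matrix.det_one_add_smul]
      rfl
    rw [e2]
    have p1 := ((Polynomial.differentiable_aeval (𝕜 := ℝ) (R := ℝ) (Matrix.det (1 + (Polynomial.X : Polynomial ℝ) • N.map Polynomial.C)).divX.divX) 0).hasDerivAt
    have := (((hasDerivAt_id (0:ℝ)).const_mul N.trace).const_add 1).add (p1.mul (hasDerivAt_pow 2 (0:ℝ)))
    exact HasDerivAt.congr_deriv this (by simp)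
  have h4 := h2.unique h3
  rw [← h4]
  exact h1

lemma det_deriv_clm {E : Type*} [NormedAddCommGroup E] [NormedSpace ℝ E] [FiniteDimensional ℝ E]
    {M : ℝ → E →L[ℝ] E} {N : E →L[ℝ] E} {t : ℝ} (h : HasDerivAt M (N ∘L M t) t)
    (hN : LinearMap.trace ℝ E N.toLinearMap = 0) :
    HasDerivAt (fun s => (M s).det) 0 t := by
  let b := Module.finBasis ℝ E
  have h1 := det_deriv (M := fun s => LinearMap.toMatrix b b (M s).toLinearMap)
    (N := LinearMap.toMatrix b b N.toLinearMap) (t := t) (by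
      intro i j
      rw [← LinearMap.toMatrix_comp b b b]
      simp only [LinearMap.toMatrix_apply]
      let φ : (E →L[ℝ] E) →L[ℝ] ℝ := LinearMap.toContinuousLinearMap
        ((b.coord i) ∘ₗ (ContinuousLinearMap.apply ℝ E (b j)).toLinearMap)
      exact φ.hasFDerivAt.comp_hasDerivAt t h)
  have h2 : (LinearMap.toMatrix b b N.toLinearMap).trace = 0 := by
    rw [← hN, LinearMap.trace_eq_matrix_trace ℝ b]
  rw [h2, zero_mul] at h1
  convert h1 using 2 with s
  rw [LinearMap.det_toMatrix]

section psi
variable {E : Type*} [NormedAddCommGroup E] [NormedSpace ℝ E] [CompleteSpace E]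

noncomputable def psi (B : E →L[ℝ] E →L[ℝ] E) (y : E) : E := Phi B 1 (1, 0, 0, y)

def PG (B : E →L[ℝ] E →L[ℝ] E) (y : E) : Prop := Good B 1 (1, 0, 0, y)

lemma PG_ev (B : E →L[ℝ] E →L[ℝ] E) : ∀ᶠ y in 𝓝 0, PG B y := by
  have t : Tendsto (fun y : E => ((1, 0, 0, y) : Par E)) (𝓝 0) (𝓝 (1, 0, 0, 0)) :=
    Continuous.tendsto' (by fun_prop) _ _ rfl
  exact t.eventually (Good_ev B 1).self_of_nhds

lemma PG.contDiffAt {B : E →L[ℝ] E →L[ℝ] E} {y : E} (h : PG B y) : ContDiffAt ℝ 2 (psi B) y :=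
  ContDiffAt.comp (g := Phi B 1) (f := fun y : E => ((1, 0, 0, y) : Par E)) y h.1 (by fun_prop)

lemma PG.curve {B : E →L[ℝ] E →L[ℝ] E} {y : E} (h : PG B y) :
    ∃ γ : ℝ → E, γ 0 = y ∧ γ 1 = psi B y ∧ Sol (fun z => B z z) γ := by
  obtain ⟨γ, h0, h1, h2⟩ := h.2
  exact ⟨γ, h0, h1, h2.congr fun z => by simp [fld]⟩

lemma PG.eq {B : E →L[ℝ] E →L[ℝ] E} {y : E} (h : PG B y) {γ : ℝ → E} (h0 : γ 0 = y)
    (hs : Sol (fun z => B z z) γ) : γ 1 = psi B y := by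
  obtain ⟨β, b0, b1, b2⟩ := h.2
  rw [← show β 1 = psi B y from b1]
  exact (hs.congr (g := fld B (1, 0, 0, y)) fun z => by simp [fld]).unique b2 (h0.trans b0.symm)
    (by simp)

/-- identity for the derivative of the flow map -/
lemma psi_euler {B : E →L[ℝ] E →L[ℝ] E} {r : ℝ} (hr : ∀ y ∈ Metric.ball (0:E) r, PG B y) {y : E}
    (hy : y ∈ Metric.ball (0:E) r) :
    fderiv ℝ (psi B) y y = psi B y + B (psi B y) (psi B y) := by
  obtain ⟨γ, h0, h1, hs⟩ := (hr y hy).curve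
  have hy' : ‖y‖ < r := by simpa using hy
  have key : ∀ t ∈ Icc (0:ℝ) 1, psi B (t • y) = t • γ t := by
    intro t ht
    have hm : t • y ∈ Metric.ball (0:E) r := by
      rw [mem_ball_zero_iff, norm_smul, Real.norm_of_nonneg ht.1]
      nlinarith [ht.1, ht.2, norm_nonneg y]
    have hsub := (hs.sub (a := 0) (d := t) le_rfl ht.1 (by linarith [ht.2])).const_smul t
      (g := fun z => B z z) (fun z => by simp)
    have := (hr _ hm).eq (by simp [h0]) hsub
    rw [← this]; simp
  have d1 : HasDerivWithinAt (fun t : ℝ => t • γ t) (psi B y + B (psi B y) (psi B y)) (Icc 0 1) 1 := by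
    have := (hasDerivWithinAt_id (1:ℝ) (Icc (0:ℝ) 1)).smul (hs 1 (by simp))
    rw [h1] at this
    exact HasDerivWithinAt.congr_deriv this (by simp [add_comm])
  have d2 : HasDerivWithinAt (fun t : ℝ => psi B (t • y)) (fderiv ℝ (psi B) y y) (Icc 0 1) 1 := by
    have e : HasDerivAt (fun t : ℝ => t • y) y 1 := by
      simpa using (hasDerivAt_id (1:ℝ)).smul_const y
    have := HasFDerivAt.comp_hasDerivAt_of_eq (1:ℝ)
      ((hr y hy).contDiffAt.differentiableAt (by norm_num)).hasFDerivAt e (by simp)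
    exact this.hasDerivWithinAt
  have d3 := d1.congr key (key 1 (by simp))
  exact (uniqueDiffOn_Icc zero_lt_one 1 (by simp)).eq_deriv _ d2 d3

lemma psi_zero_fderiv (B : E →L[ℝ] E →L[ℝ] E) : fderiv ℝ (psi B) 0 = ContinuousLinearMap.id ℝ E := by
  obtain ⟨L, hL, hL'⟩ := Phi_fderiv B 1
  have h1 : HasFDerivAt (fun t : E => ((1, 0, 0, t) : Par E))
      ((0 : E →L[ℝ] ℝ).prod ((0 : E →L[ℝ] (E →L[ℝ] E)).prod
        ((0 : E →L[ℝ] E).prod (ContinuousLinearMap.id ℝ E)))) 0 :=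
    (hasFDerivAt_const _ _).prodMk ((hasFDerivAt_const _ _).prodMk
      ((hasFDerivAt_const _ _).prodMk (hasFDerivAt_id _)))
  have h2 : HasFDerivAt (psi B) _ 0 := HasFDerivAt.comp (0:E) hL h1
  rw [h2.fderiv]
  refine ContinuousLinearMap.ext fun v => ?_
  simp [hL']

lemma psi_second {B : E →L[ℝ] E →L[ℝ] E} (hB : ∀ x y, B x y = B y x) {r : ℝ}
    (hr : ∀ y ∈ Metric.ball (0:E) r, PG B y) {y : E}
    (hy : y ∈ Metric.ball (0:E) r) :
    fderiv ℝ (fderiv ℝ (psi B)) y y = (2:ℝ) • (B (psi B y)) ∘L fderiv ℝ (psi B) y := by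
  have hc := (hr y hy).contDiffAt
  have hd : HasFDerivAt (psi B) (fderiv ℝ (psi B) y) y :=
    (hc.differentiableAt (by norm_num)).hasFDerivAt
  have hdd : DifferentiableAt ℝ (fderiv ℝ (psi B)) y :=
    (hc.fderiv_right (m := 1) (by norm_num)).differentiableAt (by norm_num)
  have e1 := hdd.hasFDerivAt.clm_apply (hasFDerivAt_id y)
  have e2 := hd.add ((B.hasFDerivAt.comp y hd).clm_apply hd)
  have heq : (fun z => fderiv ℝ (psi B) z (id z)) =ᶠ[𝓝 y]
      fun z => psi B z + B (psi B z) (psi B z) := by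
    filter_upwards [Metric.isOpen_ball.mem_nhds hy] with z hz
    exact psi_euler hr hz
  have e3 := e1.unique (e2.congr_of_eventuallyEq heq)
  refine ContinuousLinearMap.ext fun v => ?_
  have := congrArg (fun f : E →L[ℝ] E => f v) e3
  have hsym := (hc.isSymmSndFDerivAt (by simp)) y v
  simp at this
  rw [hsym, this, hB (fderiv ℝ (psi B) y v)]
  simp [two_smul]

lemma psi_det [FiniteDimensional ℝ E] {B : E →L[ℝ] E →L[ℝ] E} (hB : ∀ x y, B x y = B y x)
    (htr : ∀ x, LinearMap.trace ℝ E (B x).toLinearMap = 0) {r : ℝ}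
    (hr : ∀ y ∈ Metric.ball (0:E) r, PG B y) {y : E}
    (hy : y ∈ Metric.ball (0:E) r) : (fderiv ℝ (psi B) y).det = 1 := by
  have hy' : ‖y‖ < r := by simpa using hy
  have hm : ∀ t ∈ Icc (0:ℝ) 1, t • y ∈ Metric.ball (0:E) r := by
    intro t ht
    rw [mem_ball_zero_iff, norm_smul, Real.norm_of_nonneg ht.1]
    nlinarith [ht.1, ht.2, norm_nonneg y]
  have hdd : ∀ z ∈ Metric.ball (0:E) r, DifferentiableAt ℝ (fderiv ℝ (psi B)) z := fun z hz =>
    ((hr z hz).contDiffAt.fderiv_right (m := 1) (by norm_num)).differentiableAt (by norm_num)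
  have hM : ∀ t ∈ Icc (0:ℝ) 1, HasDerivAt (fun t : ℝ => fderiv ℝ (psi B) (t • y))
      (fderiv ℝ (fderiv ℝ (psi B)) (t • y) y) t := by
    intro t ht
    have e : HasDerivAt (fun t : ℝ => t • y) y t := by
      simpa using (hasDerivAt_id t).smul_const y
    exact HasFDerivAt.comp_hasDerivAt t (hdd _ (hm t ht)).hasFDerivAt e
  obtain ⟨c, hc, hc'⟩ := exists_hasDerivAt_eq_slope
    (fun t : ℝ => (fderiv ℝ (psi B) (t • y)).det) (fun _ => 0) zero_lt_one
    (fun t ht => by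
      have := (hM t ht).continuousAt
      exact (ContinuousLinearMap.continuous_det.continuousAt.comp this).continuousWithinAt)
    (fun t ht => by
      have ht' : t ∈ Icc (0:ℝ) 1 := ⟨ht.1.le, ht.2.le⟩
      have ht0 : t ≠ 0 := ht.1.ne'
      refine det_deriv_clm (N := (t⁻¹ * 2) • B (psi B (t • y))) ?_ ?_
      · have e := psi_second hB hr (hm t ht')
        rw [map_smul] at e
        have e' : fderiv ℝ (fderiv ℝ (psi B)) (t • y) y =
            t⁻¹ • (t • fderiv ℝ (fderiv ℝ (psi B)) (t • y) y) := by
          rw [smul_smul, inv_mul_cancel₀ ht0, one_smul]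
        have := hM t ht'
        rw [e', e, smul_smul] at this
        exact this
      · have : ((t⁻¹ * 2) • B (psi B (t • y))).toLinearMap =
            (t⁻¹ * 2) • (B (psi B (t • y))).toLinearMap := rfl
        rw [this, map_smul, htr, smul_zero])
  simp [psi_zero_fderiv] at hc'
  have hid : (ContinuousLinearMap.id ℝ E).det = 1 := by
    show LinearMap.det (LinearMap.id) = 1
    exact LinearMap.det_id
  linarith

end psi
end MRB


namespace MRB
open Filter Topology

section liouville
variable {E : Type*} [NormedAddCommGroup E] [NormedSpace ℝ E] [FiniteDimensional ℝ E]
  [CompleteSpace E]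

lemma Sol.energy {B : E →L[ℝ] E →L[ℝ] E} {Q : E →L[ℝ] E →L[ℝ] ℝ} (hQs : ∀ x y, Q x y = Q y x)
    (hQ0 : ∀ x, Q x (B x x) = 0) {γ : ℝ → E} (h : Sol (fun z => B z z) γ) :
    Q (γ 1) (γ 1) = Q (γ 0) (γ 0) := by
  obtain ⟨c, hc, hc'⟩ := exists_hasDerivAt_eq_slope (fun t => Q (γ t) (γ t)) (fun _ => 0)
    zero_lt_one (fun t ht => by
      have := (h t ht).continuousWithinAt
      exact (Q.continuous.continuousAt.comp_continuousWithinAt this).clm_apply this)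
    (fun t ht => by
      have h1 : HasDerivAt γ (B (γ t) (γ t)) t :=
        (h t ⟨ht.1.le, ht.2.le⟩).hasDerivAt (Icc_mem_nhds ht.1 ht.2)
      have h2 := (Q.hasFDerivAt.comp_hasDerivAt t h1).clm_apply h1
      refine HasDerivAt.congr_deriv h2 ?_
      simp [hQs (B (γ t) (γ t)), hQ0])
  simp at hc'
  linarith

lemma back_inv {B : E →L[ℝ] E →L[ℝ] E} (hB : ∀ x y, B x y = B y x)
    (htr : ∀ x, LinearMap.trace ℝ E (B x).toLinearMap = 0) {r : ℝ}
    (hr : ∀ y ∈ Metric.ball (0:E) r, PG B y) {D : Set E} (hDr : D ⊆ Metric.ball 0 r)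
    (hDs : ∀ y ∈ D, -y ∈ D) (hDψ : ∀ y ∈ D, psi B y ∈ D)
    {S : Set E} (hS : IsOpen S) (hSD : S ⊆ D) (hSψ : ∀ y ∈ S, psi B y ∈ S) {y : E} (hy : y ∈ S) :
    - psi B (-y) ∈ closure S := by
  let _ : MeasurableSpace E := borel E
  have _ : BorelSpace E := ⟨rfl⟩
  let μ : MeasureTheory.Measure E := MeasureTheory.Measure.addHaar
  have hinv : ∀ z ∈ D, psi B (- psi B (-z)) = z := by
    intro z hz
    have hz' := hDs z hz
    obtain ⟨γ, h0, h1, hs⟩ := (hr _ (hDr hz')).curve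
    have hrev := hs.reverse.const_smul (-1) (g := fun z => B z z) (fun z => by simp)
    have := (hr _ (hDr (hDs _ (hDψ _ hz')))).eq (by simp [h1]) hrev
    rw [← this]; simp [h0]
  have hinv' : ∀ z ∈ D, - psi B (- psi B z) = z := by
    intro z hz
    have := hinv (-z) (hDs z hz)
    rw [neg_neg] at this
    rw [this, neg_neg]
  have hinj : InjOn (psi B) S := by
    intro a ha b hb hab
    rw [← hinv' a (hSD ha), hab, hinv' b (hSD hb)]
  have hμ : μ S = μ (psi B '' S) := by
    rw [← MeasureTheory.lintegral_abs_det_fderiv_eq_addHaar_image μ hS.measurableSet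
      (f' := fderiv ℝ (psi B)) (fun x hx => ((hr x (hDr (hSD hx))).contDiffAt.differentiableAt
        (by norm_num)).hasFDerivAt.hasFDerivWithinAt) hinj]
    rw [MeasureTheory.setLIntegral_congr_fun (g := fun _ => 1) hS.measurableSet]
    · simp
    · intro x hx
      simp [psi_det hB htr hr (hDr (hSD hx))]
  have hfin : μ S ≠ ⊤ := by
    refine ne_top_of_le_ne_top ?_ (MeasureTheory.measure_mono (hSD.trans hDr))
    exact (MeasureTheory.measure_ball_lt_top (μ := μ)).ne
  have hcl : y ∈ closure (psi B '' S) := by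
    by_contra hcon
    obtain ⟨U, hU1, hU2, hU3⟩ := mem_nhds_iff.1 (isClosed_closure.isOpen_compl.mem_nhds hcon)
    have hpos : 0 < μ (S ∩ U) := (hS.inter hU2).measure_pos μ ⟨y, hy, hU3⟩
    have hsub : psi B '' S ⊆ S \ U := by
      rintro _ ⟨z, hz, rfl⟩
      exact ⟨hSψ z hz, fun hzU => hU1 hzU (subset_closure ⟨z, hz, rfl⟩)⟩
    have h1 := MeasureTheory.measure_inter_add_sdiff (μ := μ) S hU2.measurableSet
    have h2 : μ S ≤ μ (S \ U) := hμ ▸ MeasureTheory.measure_mono hsub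
    have h3 : μ (S \ U) ≠ ⊤ := ne_top_of_le_ne_top hfin (MeasureTheory.measure_mono sdiff_subset)
    rw [← h1] at h2
    have h4 : μ (S \ U) < μ (S ∩ U) + μ (S \ U) := by
      rw [add_comm]
      exact ENNReal.lt_add_right h3 hpos.ne'
    exact absurd h2 (not_le.2 h4)
  have hcont : ContinuousAt (fun z => - psi B (-z)) y := by
    have h1 : ContinuousAt (psi B) (-y) := (hr _ (hDr (hDs _ (hSD hy)))).contDiffAt.continuousAt
    exact (ContinuousAt.comp (g := psi B) h1 continuousAt_neg).neg
  have := mem_closure_image hcont hcl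
  refine closure_mono ?_ this
  rintro _ ⟨_, ⟨z, hz, rfl⟩, rfl⟩
  show - psi B (- psi B z) ∈ S
  rw [hinv' z (hSD hz)]
  exact hz

/-- the closure of a forward invariant open set is invariant under small flow maps, in both
directions of time -/
lemma closure_inv {B : E →L[ℝ] E →L[ℝ] E} (hB : ∀ x y, B x y = B y x)
    (htr : ∀ x, LinearMap.trace ℝ E (B x).toLinearMap = 0)
    {Q : E →L[ℝ] E →L[ℝ] ℝ} (hQs : ∀ x y, Q x y = Q y x)
    (hQ0 : ∀ x, Q x (B x x) = 0) {m : ℝ} (hm : 0 < m) (hQm : ∀ x, m * ‖x‖ ^ 2 ≤ Q x x)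
    {V : Submodule ℝ E} {O : Set E} (hO : IsOpen O)
    (hst : ∀ x ∈ O, ∀ y, Step B V 0 x y → y ∈ O) :
    ∃ D ∈ 𝓝 (0:E), ∀ s : ℝ, s ≠ 0 → ∀ x ∈ closure O, s • x ∈ D → ∀ γ : ℝ → E, γ 0 = x →
      Sol (fun z => s • vf B 0 0 z) γ → γ 1 ∈ closure O := by
  obtain ⟨r, hr0, hr⟩ := Metric.eventually_nhds_iff_ball.1 (PG_ev B)
  set D : Set E := {y | Q y y < m * r ^ 2} with hD
  have hDo : IsOpen D := isOpen_lt (by fun_prop) continuous_const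
  have hDr : D ⊆ Metric.ball 0 r := by
    intro y hy
    rw [mem_ball_zero_iff]
    have h1 : m * ‖y‖ ^ 2 < m * r ^ 2 := (hQm y).trans_lt hy
    have h2 := lt_of_mul_lt_mul_left h1 hm.le
    exact lt_of_pow_lt_pow_left₀ 2 hr0.le h2
  have hDs : ∀ y ∈ D, -y ∈ D := by
    intro y hy
    simpa [hD] using hy
  have hDψ : ∀ y ∈ D, psi B y ∈ D := by
    intro y hy
    obtain ⟨γ, h0, h1, hs⟩ := (hr _ (hDr hy)).curve
    have := hs.energy hQs hQ0
    rw [h0, h1] at this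
    show Q _ _ < _
    rw [this]; exact hy
  have hval : ∀ s : ℝ, s ≠ 0 → ∀ x : E, s • x ∈ D → ∀ γ : ℝ → E, γ 0 = x →
      Sol (fun z => s • vf B 0 0 z) γ → γ 1 = s⁻¹ • psi B (s • x) := by
    intro s hs x hx γ h0 hγ
    have h1 := hγ.const_smul s (g := fun z => B z z) (fun z => by simp [vf])
    have := (hr _ (hDr hx)).eq (by simp [h0]) h1
    rw [← this, smul_smul, inv_mul_cancel₀ hs, one_smul]
  have hfwd : ∀ s : ℝ, 0 < s → ∀ x ∈ O, s • x ∈ D → s⁻¹ • psi B (s • x) ∈ O := by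
    intro s hs x hx hxD
    obtain ⟨γ, h0, h1, hγ⟩ := (hr _ (hDr hxD)).curve
    refine hst x hx _ ⟨s, hs, 0, V.zero_mem, fun t => s⁻¹ • γ t, ?_, ?_, ?_⟩
    · simp [h0, smul_smul, hs.ne']
    · simp [h1]
    · refine hγ.const_smul s⁻¹ fun z => ?_
      simp [vf, smul_smul, hs.ne']
  have hbwd : ∀ s : ℝ, 0 < s → ∀ x ∈ O, s • x ∈ D → (-s)⁻¹ • psi B ((-s) • x) ∈ closure O := by
    intro s hs x hx hxD
    set S : Set E := {y | s⁻¹ • y ∈ O} ∩ D with hS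
    have hSo : IsOpen S := (hO.preimage (by fun_prop : Continuous fun y : E => s⁻¹ • y)).inter hDo
    have hb := back_inv hB htr hr hDr hDs hDψ hSo inter_subset_right (by
      rintro y ⟨hy1, hy2⟩
      refine ⟨?_, hDψ y hy2⟩
      have := hfwd s hs _ hy1 (by rwa [smul_smul, mul_inv_cancel₀ hs.ne', one_smul])
      rwa [smul_smul, mul_inv_cancel₀ hs.ne', one_smul] at this)
      (y := s • x) ⟨by simpa [smul_smul, hs.ne'] using hx, hxD⟩
    have h2 := mem_closure_image (f := fun y : E => s⁻¹ • y) (by fun_prop) hb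
    have h3 : (fun y : E => s⁻¹ • y) '' S ⊆ O := by
      rintro _ ⟨y, hy, rfl⟩
      exact hy.1
    have := closure_mono h3 h2
    simpa using this
  refine ⟨D, hDo.mem_nhds (by simp [hD]; positivity), ?_⟩
  intro s hs x hx hxD γ h0 hγ
  rw [hval s hs x hxD γ h0 hγ]
  have hopen : IsOpen {z : E | s • z ∈ D} := hDo.preimage (by fun_prop)
  have hx2 : x ∈ closure (O ∩ {z : E | s • z ∈ D}) := by
    rw [inter_comm]; exact hopen.inter_closure ⟨hxD, hx⟩
  have hc : ContinuousAt (fun z => s⁻¹ • psi B (s • z)) x := by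
    have h1 : ContinuousAt (psi B) (s • x) := (hr _ (hDr hxD)).contDiffAt.continuousAt
    exact (ContinuousAt.comp (g := psi B) (f := fun z : E => s • z) h1 (by fun_prop)).const_smul _
  have h3 := mem_closure_image hc hx2
  refine closure_minimal ?_ isClosed_closure h3
  rintro _ ⟨z, ⟨hz1, hz2⟩, rfl⟩
  rcases lt_or_gt_of_ne hs with hneg | hpos
  · have := hbwd (-s) (by linarith) z hz1 (by
      have := hDs _ hz2
      simpa using this)
    simpa using this
  · exact subset_closure (hfwd s hpos z hz1 hz2)

end liouville
end MRB


namespace MRB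
open Filter Topology

section density
variable {E : Type*} [NormedAddCommGroup E] [NormedSpace ℝ E] [FiniteDimensional ℝ E]
  [CompleteSpace E]

lemma Phi_const {B : E →L[ℝ] E →L[ℝ] E} {c : E} (h : Good B 0 (0, 0, c, 0)) :
    Phi B 0 (0, 0, c, 0) = c := by
  obtain ⟨-, γ, h0, h1, hs⟩ := h
  have h2 : Sol (fld B (0, 0, c, 0)) (fun t => t • c) := by
    intro t _
    have : HasDerivAt (fun t : ℝ => t • c) c t := by
      simpa using (hasDerivAt_id t).smul_const c
    simpa [fld] using this.hasDerivWithinAt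
  have := hs.unique h2 (by simp [h0]) (show (1:ℝ) ∈ Icc (0:ℝ) 1 by simp)
  rw [← h1, this]; simp

lemma iter_add {A : Set E} {v : E}
    (h : ∀ᶠ τ : ℝ in 𝓝 0, ∀ x ∈ A, x + τ • v ∈ A) (τ : ℝ) : ∀ x ∈ A, x + τ • v ∈ A := by
  have tm : Tendsto (fun m : ℕ => τ / ((m:ℝ) + 1)) atTop (𝓝 0) := by
    have := (tendsto_const_div_atTop_nhds_zero_nat τ).comp (tendsto_add_atTop_nat 1)
    simpa [Function.comp_def] using this
  obtain ⟨m, hm⟩ := (tm.eventually h).exists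
  intro x hx
  have key : ∀ k : ℕ, x + ((k:ℝ) * (τ / ((m:ℝ) + 1))) • v ∈ A := by
    intro k
    induction k with
    | zero => simpa using hx
    | succ k ih =>
      have := hm _ ih
      rw [add_assoc, ← add_smul] at this
      push_cast
      rwa [add_mul, one_mul]
  have := key (m + 1)
  push_cast at this
  rwa [mul_div_cancel₀] at this
  positivity

lemma good_small (B : E →L[ℝ] E →L[ℝ] E) (v : E) :
    ∀ᶠ τ : ℝ in 𝓝 0, ∀ᶠ p in 𝓝 ((0, 0, τ • v, 0) : Par E), Good B 0 p := by
  have t : Tendsto (fun τ : ℝ => ((0, 0, τ • v, 0) : Par E)) (𝓝 0) (𝓝 (0, 0, 0, 0)) :=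
    Continuous.tendsto' (by fun_prop) _ _ (by simp)
  exact t.eventually (Good_ev B 0)

theorem dense_of_steps {B : E →L[ℝ] E →L[ℝ] E} (hB : ∀ x y, B x y = B y x)
    (htr : ∀ x, LinearMap.trace ℝ E (B x).toLinearMap = 0)
    {Q : E →L[ℝ] E →L[ℝ] ℝ} (hQs : ∀ x y, Q x y = Q y x)
    (hQ0 : ∀ x, Q x (B x x) = 0) {m : ℝ} (hm : 0 < m) (hQm : ∀ x, m * ‖x‖ ^ 2 ≤ Q x x)
    {V : Submodule ℝ E}
    (hgen : ∀ W : Submodule ℝ E, V ≤ W → (∀ x ∈ W, ∀ y ∈ W, B x y ∈ W) → W = ⊤)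
    {O : Set E} (hO : IsOpen O) (hne : O.Nonempty)
    (hst : ∀ x ∈ O, ∀ y, Step B V 0 x y → y ∈ O) : Dense O := by
  obtain ⟨D, hD, hinv⟩ := closure_inv hB htr hQs hQ0 hm hQm hO hst
  let W : Submodule ℝ E :=
    { carrier := {v | ∀ τ : ℝ, ∀ x ∈ closure O, x + τ • v ∈ closure O}
      add_mem' := by
        intro a b ha hb τ x hx
        have := hb τ _ (ha τ x hx)
        rwa [add_assoc, ← smul_add] at this
      zero_mem' := by
        intro τ x hx
        simpa using hx
      smul_mem' := by
        intro c v hv τ x hx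
        rw [smul_smul]
        exact hv _ x hx }
  have hVW : V ≤ W := by
    intro v hv
    show ∀ τ : ℝ, _
    apply iter_add
    filter_upwards [good_small B v] with τ hτ
    have hx0 : ∀ x ∈ O, x + τ • v ∈ closure O := by
      intro x hx
      have t1 : Tendsto (fun T : ℝ => ((T, T • ((2:ℝ) • B x - (0:ℝ) • ContinuousLinearMap.id ℝ E),
          T • vf B 0 0 x + τ • v, 0) : Par E)) (𝓝[>] 0) (𝓝 (0, 0, τ • v, 0)) :=
        (Continuous.tendsto' (by fun_prop) _ _ (by simp)).mono_left nhdsWithin_le_nhds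
      have t2 := (hτ.self_of_nhds.1.continuousAt.tendsto.comp t1).const_add x
      rw [Phi_const hτ.self_of_nhds] at t2
      refine mem_closure_of_tendsto t2 ?_
      filter_upwards [t1.eventually hτ, self_mem_nhdsWithin] with T hT hT0
      have hT0 : 0 < T := hT0
      have e : ((T, T • ((2:ℝ) • B x - (0:ℝ) • ContinuousLinearMap.id ℝ E),
          T • vf B 0 0 x + τ • v, 0) : Par E) = PP B T 0 (T⁻¹ • τ • v) x 0 := by
        simp [PP, vf, smul_smul, hT0.ne', ← mul_assoc]
      rw [e] at hT
      have := hT.step hB hT0 (V.smul_mem T⁻¹ (V.smul_mem τ hv))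
      rw [add_zero, ← e] at this
      exact hst x hx _ this
    intro x hx
    have hc : ContinuousAt (fun x : E => x + τ • v) x := by fun_prop
    have := mem_closure_image hc hx
    refine closure_minimal ?_ isClosed_closure this
    rintro _ ⟨z, hz, rfl⟩
    exact hx0 z hz
  have hFW : ∀ v ∈ W, B v v ∈ W := by
    intro v hv
    have hv : ∀ τ : ℝ, ∀ x ∈ closure O, x + τ • v ∈ closure O := hv
    show ∀ τ : ℝ, _
    apply iter_add
    filter_upwards [good_small B (B v v)] with τ hτ x hx
    rcases eq_or_ne τ 0 with rfl | hτ0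
    · simpa using hx
    have t1 : Tendsto (fun η : ℝ => ((τ * η ^ 2, (τ * η ^ 2) • ((2:ℝ) • B x) + (τ * η) • ((2:ℝ) • B v),
          τ • (η ^ 2 • B x x + (2 * η) • B x v + B v v), 0) : Par E)) (𝓝[>] 0)
          (𝓝 (0, 0, τ • B v v, 0)) :=
        (Continuous.tendsto' (by fun_prop) _ _ (by simp)).mono_left nhdsWithin_le_nhds
    have t2 := (hτ.self_of_nhds.1.continuousAt.tendsto.comp t1).const_add x
    rw [Phi_const hτ.self_of_nhds] at t2
    have t3 : Tendsto (fun η : ℝ => (τ * η ^ 2) • x + (τ * η) • v) (𝓝[>] 0) (𝓝 0) :=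
      (Continuous.tendsto' (by fun_prop) _ _ (by simp)).mono_left nhdsWithin_le_nhds
    refine isClosed_closure.mem_of_tendsto t2 ?_
    filter_upwards [t1.eventually hτ, self_mem_nhdsWithin, t3 hD] with η hη hη0 hηD
    have hη0 : 0 < η := hη0
    have e : ((τ * η ^ 2, (τ * η ^ 2) • ((2:ℝ) • B x) + (τ * η) • ((2:ℝ) • B v),
          τ • (η ^ 2 • B x x + (2 * η) • B x v + B v v), 0) : Par E) =
          PP B (τ * η ^ 2) 0 0 (x + η⁻¹ • v) 0 := by
      simp only [PP, vf, Prod.mk.injEq, true_and, map_add, map_smul, _root_.add_apply,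
        _root_.smul_apply, hB v x, zero_smul, sub_zero, add_zero, and_true]
      constructor
      · simp only [smul_add, smul_smul]
        congr 2
        field_simp
      · simp only [smul_add, smul_smul]
        have e1 : τ * η ^ 2 * η⁻¹ = τ * η := by field_simp
        have e2 : τ * η ^ 2 * (η⁻¹ * η⁻¹) = τ := by field_simp
        rw [e1, e2]
        module
    rw [e] at hη
    obtain ⟨γ, h0, h1, hs⟩ := hη.sol hB
    rw [add_zero] at h0
    have hmem := hinv (τ * η ^ 2) (by positivity) (x + η⁻¹ • v) (hv _ x hx) (by
      have e1 : τ * η ^ 2 * η⁻¹ = τ * η := by field_simp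
      rw [smul_add, smul_smul, e1]
      exact hηD) γ h0 hs
    have := hv (-η⁻¹) _ hmem
    rw [h1, ← e] at this
    convert this using 1
    simp only [Function.comp, neg_smul]
    abel
  have hBW : ∀ x ∈ W, ∀ y ∈ W, B x y ∈ W := by
    intro x hx y hy
    have h1 := W.sub_mem (W.sub_mem (hFW _ (W.add_mem hx hy)) (hFW x hx)) (hFW y hy)
    have h2 := W.smul_mem (2⁻¹ : ℝ) h1
    convert h2 using 1
    simp only [map_add, _root_.add_apply, hB y x]
    module
  have hW := hgen W hVW hBW
  obtain ⟨x, hx⟩ := hne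
  intro y
  have : y - x ∈ W := by rw [hW]; trivial
  have := (show ∀ τ : ℝ, ∀ z ∈ closure O, z + τ • (y - x) ∈ closure O from this) 1 x
    (subset_closure hx)
  simpa using this

theorem global_reach {B : E →L[ℝ] E →L[ℝ] E} (hB : ∀ x y, B x y = B y x)
    (htr : ∀ x, LinearMap.trace ℝ E (B x).toLinearMap = 0)
    {Q : E →L[ℝ] E →L[ℝ] ℝ} (hQs : ∀ x y, Q x y = Q y x)
    (hQ0 : ∀ x, Q x (B x x) = 0) {m : ℝ} (hm : 0 < m) (hQm : ∀ x, m * ‖x‖ ^ 2 ≤ Q x x)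
    {V : Submodule ℝ E}
    (hgen : ∀ W : Submodule ℝ E, V ≤ W → (∀ x ∈ W, ∀ y ∈ W, B x y ∈ W) → W = ⊤)
    (ν : ℝ) (x y : E) : Reach B V ν x y := by
  set O : Set E := {y | Rob B V 0 y} with hOdef
  have hO : IsOpen O := Rob.isOpen B V 0
  have hne : O.Nonempty := exists_Rob hB hgen
  have hd : Dense O := dense_of_steps hB htr hQs hQ0 hm hQm hgen hO hne
    (fun x hx y hxy => Rob.step hB hx hxy)
  have hO' : IsOpen {y : E | -y ∈ O} := hO.preimage continuous_neg
  obtain ⟨z, hz1, hz2⟩ := hd.inter_open_nonempty _ hO' (by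
    obtain ⟨w, hw⟩ := hne
    exact ⟨-w, by simpa using hw⟩)
  have h1 : Rob B V 0 (-z) := hz1
  have h2 := h1.neg
  rw [neg_neg, neg_zero] at h2
  exact (Rob.trans hz2 h2).global ν x y

end density
end MRB


namespace MRB
open Filter Topology

section generic
variable {E : Type*} [NormedAddCommGroup E] [NormedSpace ℝ E]

/-- Nonassociative words in two letters, as functions of the letters. -/
inductive Wd (B : E →L[ℝ] E →L[ℝ] E) : (E × E → E) → Prop
  | fst : Wd B (fun p => p.1)
  | snd : Wd B (fun p => p.2)
  | mul {f g : E × E → E} (hf : Wd B f) (hg : Wd B g) : Wd B (fun p => B (f p) (g p))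

lemma Wd.analytic {B : E →L[ℝ] E →L[ℝ] E} {f : E × E → E} (h : Wd B f) (p : E × E) :
    AnalyticAt ℝ f p := by
  induction h with
  | fst => exact analyticAt_fst
  | snd => exact analyticAt_snd
  | mul hf hg ihf ihg =>
    rename_i f g
    exact AnalyticAt.comp₂ (h := fun q : E × E => B q.1 q.2) (B.analyticAt_bilinear _) ihf ihg

lemma Wd.mem {B : E →L[ℝ] E →L[ℝ] E} {f : E × E → E} (h : Wd B f) {p : E × E}
    {W : Submodule ℝ E} (h1 : p.1 ∈ W) (h2 : p.2 ∈ W) (hW : ∀ x ∈ W, ∀ y ∈ W, B x y ∈ W) :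
    f p ∈ W := by
  induction h with
  | fst => exact h1
  | snd => exact h2
  | mul hf hg ihf ihg => exact hW _ ihf _ ihg

lemma Wd.span_mul (B : E →L[ℝ] E →L[ℝ] E) (p : E × E) :
    ∀ x ∈ Submodule.span ℝ {v | ∃ f, Wd B f ∧ f p = v},
    ∀ y ∈ Submodule.span ℝ {v | ∃ f, Wd B f ∧ f p = v},
    B x y ∈ Submodule.span ℝ {v | ∃ f, Wd B f ∧ f p = v} := by
  intro x hx y hy
  induction hx, hy using Submodule.span_induction₂ with
  | mem_mem x y hx hy =>
    obtain ⟨f, hf, rfl⟩ := hx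
    obtain ⟨g, hg, rfl⟩ := hy
    exact Submodule.subset_span ⟨_, hf.mul hg, rfl⟩
  | zero_left y hy => simp
  | zero_right x hx => simp
  | add_left x y z hx hy hz h1 h2 => simpa using Submodule.add_mem _ h1 h2
  | add_right x y z hx hy hz h1 h2 => simpa using Submodule.add_mem _ h1 h2
  | smul_left r x y hx hy h => simpa using Submodule.smul_mem _ r h
  | smul_right r x y hx hy h => simpa using Submodule.smul_mem _ r h

/-- The generating property of a pair. -/
def Gen (B : E →L[ℝ] E →L[ℝ] E) (p : E × E) : Prop :=
  ∀ W : Submodule ℝ E, p.1 ∈ W → p.2 ∈ W → (∀ x ∈ W, ∀ y ∈ W, B x y ∈ W) → W = ⊤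

theorem generic_gen [FiniteDimensional ℝ E] {B : E →L[ℝ] E →L[ℝ] E} {p₀ : E × E}
    (h0 : Gen B p₀) : ∃ P : Set (E × E), IsOpen P ∧ Dense P ∧ ∀ p ∈ P, Gen B p := by
  have hs : Submodule.span ℝ {v | ∃ f, Wd B f ∧ f p₀ = v} = ⊤ :=
    h0 _ (Submodule.subset_span ⟨_, Wd.fst, rfl⟩) (Submodule.subset_span ⟨_, Wd.snd, rfl⟩)
      (Wd.span_mul B p₀)
  obtain ⟨k, v, hv, hsp, hli⟩ : ∃ (k : ℕ) (v : Fin k → E),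
      (∀ i, v i ∈ {v | ∃ f, Wd B f ∧ f p₀ = v}) ∧
      Submodule.span ℝ (range v) = Submodule.span ℝ {v | ∃ f, Wd B f ∧ f p₀ = v} ∧
      LinearIndependent ℝ v :=
    ⟨_, Submodule.exists_fun_fin_finrank_span_eq ℝ {v | ∃ f, Wd B f ∧ f p₀ = v}⟩
  choose f hf hfv using hv
  rw [hs] at hsp
  let b : Module.Basis (Fin k) ℝ E := Module.Basis.mk hli hsp.ge
  let d : E × E → ℝ := fun p => b.det (fun i => f i p)
  have hd : ∀ p, AnalyticAt ℝ d p := by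
    intro p
    have : d = fun p => ∑ σ : Equiv.Perm (Fin k), (Equiv.Perm.sign σ : ℝ) *
        ∏ i, b.repr (f i p) (σ i) := by
      funext p
      simp only [d, Module.Basis.det_apply, Matrix.det_apply', Module.Basis.toMatrix_apply]
    rw [this]
    refine Finset.analyticAt_fun_sum _ fun σ _ => ?_
    refine analyticAt_const.mul (Finset.analyticAt_fun_prod _ fun i _ => ?_)
    have h1 := (hf i).analytic p
    have h2 : AnalyticAt ℝ (fun x : E => b.repr x (σ i)) (f i p) :=
      (LinearMap.toContinuousLinearMap (b.coord (σ i))).analyticAt _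
    exact h2.comp h1
  have hd0 : d p₀ ≠ 0 := by
    have : (fun i => f i p₀) = b := by
      funext i
      rw [hfv i]; simp [b]
    simp only [d, this, Module.Basis.det_self]
    exact one_ne_zero
  have hc : Continuous d := continuous_iff_continuousAt.2 fun p => (hd p).continuousAt
  refine ⟨{p | d p ≠ 0}, isOpen_ne_fun hc continuous_const, ?_, ?_⟩
  · by_contra hnd
    rw [dense_iff_inter_open] at hnd
    push Not at hnd
    obtain ⟨O, hO, ⟨q, hq⟩, hem⟩ := hnd
    have hz : d =ᶠ[𝓝 q] 0 := by
      filter_upwards [hO.mem_nhds hq] with r hr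
      by_contra hne
      have : r ∈ O ∩ {p | d p ≠ 0} := ⟨hr, hne⟩
      rw [hem] at this
      exact this
    have := AnalyticOnNhd.eqOn_zero_of_preconnected_of_eventuallyEq_zero
      (fun p _ => hd p) isPreconnected_univ (mem_univ q) hz
    exact hd0 (this (mem_univ p₀))
  · intro p hp W h1 h2 hW
    have := (b.is_basis_iff_det (v := fun i => f i p)).2 (isUnit_iff_ne_zero.2 hp)
    rw [eq_top_iff, ← this.2, Submodule.span_le]
    rintro _ ⟨i, rfl⟩
    exact (hf i).mem h1 h2 hW

end generic
end MRB


namespace MRB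
open Filter Topology

section son

/-- Index set of coordinates on the skew matrices. -/
abbrev Pr (n : ℕ) := {p : Fin n × Fin n // p.1 < p.2}

/-- Coordinate space of the skew matrices. -/
abbrev EE (n : ℕ) := Pr n → ℝ

variable {n : ℕ}

/-- Skew matrix with given upper triangular entries. -/
def sk : EE n →ₗ[ℝ] Mat n where
  toFun x := Matrix.of fun i j =>
    if h : i < j then x ⟨(i, j), h⟩ else if h : j < i then -x ⟨(j, i), h⟩ else 0
  map_add' x y := by
    ext i j
    simp only [Matrix.of_apply, Matrix.add_apply, Pi.add_apply]
    split_ifs <;> ring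
  map_smul' r x := by
    ext i j
    simp only [Matrix.of_apply, Matrix.smul_apply, Pi.smul_apply, smul_eq_mul, RingHom.id_apply]
    split_ifs <;> ring

/-- Upper triangular entries. -/
def pr : Mat n →ₗ[ℝ] EE n where
  toFun M := fun p => M p.1.1 p.1.2
  map_add' x y := rfl
  map_smul' r x := rfl

lemma pr_apply (M : Mat n) (p : Pr n) : pr M p = M p.1.1 p.1.2 := rfl

lemma sk_apply (x : EE n) (i j : Fin n) : sk x i j =
    if h : i < j then x ⟨(i, j), h⟩ else if h : j < i then -x ⟨(j, i), h⟩ else 0 := rfl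

lemma sk_pair (x : EE n) (p : Pr n) : sk x p.1.1 p.1.2 = x p := by
  rw [sk_apply, dif_pos p.2]

lemma pr_sk (x : EE n) : pr (sk x) = x := by
  funext p
  exact sk_pair x p

lemma sk_swap (x : EE n) (i j : Fin n) : sk x j i = - sk x i j := by
  simp only [sk_apply]
  rcases lt_trichotomy i j with h | h | h
  · simp [h, h.not_gt]
  · subst h; simp
  · simp [h, h.not_gt]

lemma sk_diag (x : EE n) (i : Fin n) : sk x i i = 0 := by simp [sk_apply]

lemma sk_transpose (x : EE n) : (sk x)ᵀ = - sk x := by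
  ext i j
  simp [sk_swap x i j]

lemma sk_pr {M : Mat n} (h : Mᵀ = -M) : sk (pr M) = M := by
  have hsw : ∀ i j, M j i = - M i j := fun i j => by
    have := congrFun (congrFun h i) j
    simpa using this
  ext i j
  rcases lt_trichotomy i j with hij | hij | hij
  · exact sk_pair (pr M) ⟨(i, j), hij⟩
  · subst hij
    rw [sk_diag]
    have := hsw i i
    linarith
  · rw [sk_swap (pr M) j i, sk_pair (pr M) ⟨(j, i), hij⟩, hsw j i]; rfl

/-- Structure constants. -/
noncomputable def kap (c : Fin n → ℝ) (i j : Fin n) : ℝ := (c i - c j) / (c i + c j)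

lemma kap_swap (c : Fin n → ℝ) (i j : Fin n) : kap c j i = - kap c i j := by
  unfold kap
  rw [add_comm (c j), ← neg_div, neg_sub]

lemma kap_diag (c : Fin n → ℝ) (i : Fin n) : kap c i i = 0 := by simp [kap]

/-- Half of the `κ`-weighted upper triangular part. -/
noncomputable def hk (c : Fin n → ℝ) : Mat n →ₗ[ℝ] EE n where
  toFun M := fun p => kap c p.1.1 p.1.2 / 2 * M p.1.1 p.1.2
  map_add' x y := by funext p; simp [mul_add]
  map_smul' r x := by funext p; simp; ring

lemma hk_apply (c : Fin n → ℝ) (M : Mat n) (p : Pr n) :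
    hk c M p = kap c p.1.1 p.1.2 / 2 * M p.1.1 p.1.2 := rfl

/-- The Euler bilinear map. -/
noncomputable def BB (c : Fin n → ℝ) : EE n →L[ℝ] EE n →L[ℝ] EE n :=
  LinearMap.toContinuousBilinearMap
    (LinearMap.mk₂ ℝ (fun x y => hk c (sk x * sk y + sk y * sk x))
      (fun x y z => by simp only [map_add, add_mul, mul_add]; abel)
      (fun r x y => by simp only [map_smul, Matrix.smul_mul, Matrix.mul_smul, ← smul_add])
      (fun x y z => by simp only [map_add, add_mul, mul_add]; abel)
      (fun r x y => by simp only [map_smul, Matrix.smul_mul, Matrix.mul_smul, ← smul_add]))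

lemma BB_apply (c : Fin n → ℝ) (x y : EE n) :
    BB c x y = hk c (sk x * sk y + sk y * sk x) := rfl

lemma BB_symm (c : Fin n → ℝ) (x y : EE n) : BB c x y = BB c y x := by
  rw [BB_apply, BB_apply, add_comm]

lemma BB_self (c : Fin n → ℝ) (x : EE n) (p : Pr n) :
    BB c x x p = kap c p.1.1 p.1.2 * (sk x ^ 2) p.1.1 p.1.2 := by
  rw [BB_apply, hk_apply, pow_two, Matrix.add_apply]; ring

lemma sq_symm (x : EE n) (i j : Fin n) : (sk x ^ 2) j i = (sk x ^ 2) i j := by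
  have : (sk x ^ 2)ᵀ = sk x ^ 2 := by
    rw [Matrix.transpose_pow, sk_transpose]; simp
  exact congrFun (congrFun this i) j

lemma sk_BB_self (c : Fin n → ℝ) (x : EE n) (i j : Fin n) :
    sk (BB c x x) i j = kap c i j * (sk x ^ 2) i j := by
  rcases lt_trichotomy i j with hij | hij | hij
  · rw [sk_pair _ ⟨(i, j), hij⟩, BB_self]
  · subst hij; rw [sk_diag, kap_diag, zero_mul]
  · rw [sk_swap _ j i, sk_pair _ ⟨(j, i), hij⟩, BB_self, kap_swap c j i, sq_symm x j i]; ring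

lemma BB_trace (c : Fin n → ℝ) (x : EE n) :
    LinearMap.trace ℝ (EE n) (BB c x).toLinearMap = 0 := by
  rw [LinearMap.trace_eq_matrix_trace ℝ (Pi.basisFun ℝ (Pr n)), Matrix.trace]
  refine Finset.sum_eq_zero fun p _ => ?_
  rw [Matrix.diag_apply, LinearMap.toMatrix_apply]
  simp only [Pi.basisFun_repr, Pi.basisFun_apply]
  show BB c x (Pi.single p 1) p = 0
  have key : ∀ a b : Fin n, (a = p.1.1 ∧ b ≠ p.1.2) ∨ (b = p.1.2 ∧ a ≠ p.1.1) →
      sk (Pi.single p (1:ℝ)) a b = 0 := by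
    intro a b hab
    have hp := p.2
    have h1 : ∀ h : a < b, (⟨(a, b), h⟩ : Pr n) ≠ p := by
      rintro h rfl; simp at hab
    have h2 : ∀ h : b < a, (⟨(b, a), h⟩ : Pr n) ≠ p := by
      rintro h rfl
      simp at hab
      rcases hab with hab | hab
      · exact h.ne hab.1.symm
      · exact h.ne hab.1
    rw [sk_apply]
    split_ifs with h h
    · rw [Pi.single_apply, if_neg (h1 h)]
    · rw [Pi.single_apply, if_neg (h2 h), neg_zero]
    · rfl
  rw [BB_apply, hk_apply, Matrix.add_apply, Matrix.mul_apply, Matrix.mul_apply,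
    Finset.sum_eq_zero, Finset.sum_eq_zero]
  · simp
  · intro k _
    rcases eq_or_ne k p.1.2 with rfl | hk
    · rw [sk_diag, mul_zero]
    · rw [key _ _ (Or.inl ⟨rfl, hk⟩), zero_mul]
  · intro k _
    rcases eq_or_ne k p.1.1 with rfl | hk
    · rw [sk_diag, zero_mul]
    · rw [key _ _ (Or.inr ⟨rfl, hk⟩), mul_zero]

/-- Energy form. -/
noncomputable def QQ (c : Fin n → ℝ) : EE n →L[ℝ] EE n →L[ℝ] ℝ :=
  LinearMap.toContinuousBilinearMap
    (LinearMap.mk₂ ℝ (fun x y => ∑ p : Pr n, (c p.1.1 + c p.1.2) * x p * y p)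
      (fun x y z => by
        rw [← Finset.sum_add_distrib]; exact Finset.sum_congr rfl fun p _ => by simp; ring)
      (fun r x y => by
        rw [smul_eq_mul, Finset.mul_sum]; exact Finset.sum_congr rfl fun p _ => by simp; ring)
      (fun x y z => by
        rw [← Finset.sum_add_distrib]; exact Finset.sum_congr rfl fun p _ => by simp; ring)
      (fun r x y => by
        rw [smul_eq_mul, Finset.mul_sum]; exact Finset.sum_congr rfl fun p _ => by simp; ring))

lemma QQ_apply (c : Fin n → ℝ) (x y : EE n) :
    QQ c x y = ∑ p : Pr n, (c p.1.1 + c p.1.2) * x p * y p := rfl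

lemma QQ_symm (c : Fin n → ℝ) (x y : EE n) : QQ c x y = QQ c y x := by
  rw [QQ_apply, QQ_apply]; exact Finset.sum_congr rfl fun p _ => by ring

lemma sum_sym (f : Fin n → Fin n → ℝ) (hs : ∀ i j, f j i = f i j) (h0 : ∀ i, f i i = 0) :
    ∑ i, ∑ j, f i j = 2 * ∑ p : Pr n, f p.1.1 p.1.2 := by
  have h1 : ∑ p : Pr n, f p.1.1 p.1.2 = ∑ i, ∑ j, if i < j then f i j else 0 := by
    rw [← Finset.sum_product', ← Finset.sum_filter]
    rw [Finset.sum_subtype (F := inferInstance) (p := fun p : Fin n × Fin n => p.1 < p.2)]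
    simp
  have h2 : ∑ p : Pr n, f p.1.1 p.1.2 = ∑ i, ∑ j, if j < i then f i j else 0 := by
    rw [h1, Finset.sum_comm]
    refine Finset.sum_congr rfl fun i _ => Finset.sum_congr rfl fun j _ => ?_
    rw [hs]
  rw [two_mul]
  nth_rw 1 [h1]
  rw [h2]
  simp only [← Finset.sum_add_distrib]
  refine Finset.sum_congr rfl fun i _ => Finset.sum_congr rfl fun j _ => ?_
  rcases lt_trichotomy i j with hij | hij | hij
  · simp [hij, hij.not_gt]
  · subst hij; simp [h0]
  · simp [hij, hij.not_gt]

lemma QQ_zero (c : Fin n → ℝ) (hc : ∀ i, 0 < c i) (x : EE n) : QQ c x (BB c x x) = 0 := by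
  have h1 : QQ c x (BB c x x) =
      ∑ p : Pr n, (fun i j => (c i - c j) * sk x i j * (sk x ^ 2) i j) p.1.1 p.1.2 := by
    rw [QQ_apply]
    refine Finset.sum_congr rfl fun p _ => ?_
    have := (add_pos (hc p.1.1) (hc p.1.2)).ne'
    rw [BB_self, kap]
    beta_reduce
    rw [sk_pair]
    field_simp
  have h2 := sum_sym (fun i j => (c i - c j) * sk x i j * (sk x ^ 2) i j)
    (fun i j => by simp only [sk_swap x i j, sq_symm x i j]; ring) (fun i => by simp)
  have e1 : ∑ i, ∑ j, c i * sk x i j * (sk x ^ 2) i j = ∑ i, c i * (sk x ^ 3) i i := by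
    refine Finset.sum_congr rfl fun i _ => ?_
    rw [show sk x ^ 3 = sk x * sk x ^ 2 by rw [pow_succ']]
    rw [Matrix.mul_apply, Finset.mul_sum]
    refine Finset.sum_congr rfl fun j _ => ?_
    rw [sq_symm x i j]; ring
  have e2 : ∑ i, ∑ j, c j * sk x i j * (sk x ^ 2) i j = ∑ i, c i * (sk x ^ 3) i i := by
    rw [Finset.sum_comm]
    refine Finset.sum_congr rfl fun i _ => ?_
    rw [show sk x ^ 3 = sk x ^ 2 * sk x by rw [pow_succ]]
    rw [Matrix.mul_apply, Finset.mul_sum]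
    refine Finset.sum_congr rfl fun j _ => ?_
    rw [sq_symm x i j]; ring
  have h3 : ∑ i, ∑ j, (c i - c j) * sk x i j * (sk x ^ 2) i j = 0 := by
    simp only [sub_mul, Finset.sum_sub_distrib]
    rw [e1, e2, sub_self]
  rw [h3] at h2
  rw [h1]
  linarith

lemma QQ_pos (c : Fin n → ℝ) (hc : ∀ i, 0 < c i) :
    ∃ m : ℝ, 0 < m ∧ ∀ x : EE n, m * ‖x‖ ^ 2 ≤ QQ c x x := by
  obtain ⟨m, hm, hmc⟩ : ∃ m : ℝ, 0 < m ∧ ∀ p : Pr n, m ≤ c p.1.1 + c p.1.2 := by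
    rcases isEmpty_or_nonempty (Pr n) with h | h
    · exact ⟨1, one_pos, fun p => h.elim p⟩
    · obtain ⟨q, hq⟩ := Finite.exists_min (fun p : Pr n => c p.1.1 + c p.1.2)
      exact ⟨_, add_pos (hc _) (hc _), hq⟩
  refine ⟨m, hm, fun x => ?_⟩
  have h0 : ∀ p : Pr n, 0 ≤ (c p.1.1 + c p.1.2) * x p * x p := fun p => by
    rw [mul_assoc]
    exact mul_nonneg (add_pos (hc _) (hc _)).le (mul_self_nonneg _)
  have hQ : 0 ≤ QQ c x x := by
    rw [QQ_apply]; exact Finset.sum_nonneg fun p _ => h0 p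
  have h1 : ‖x‖ ≤ √(QQ c x x / m) := by
    rw [pi_norm_le_iff_of_nonneg (Real.sqrt_nonneg _)]
    intro p
    rw [Real.norm_eq_abs]
    apply Real.abs_le_sqrt
    rw [le_div_iff₀ hm]
    have h2 : (c p.1.1 + c p.1.2) * x p * x p ≤ QQ c x x := by
      rw [QQ_apply]
      exact Finset.single_le_sum (f := fun p : Pr n => (c p.1.1 + c p.1.2) * x p * x p)
        (fun p _ => h0 p) (Finset.mem_univ p)
    nlinarith [hmc p, mul_self_nonneg (x p)]
  have h2 : ‖x‖ ^ 2 ≤ QQ c x x / m := by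
    rw [← Real.sq_sqrt (div_nonneg hQ hm.le)]
    gcongr
  rw [le_div_iff₀ hm] at h2
  linarith

end son
end MRB


namespace MRB
open Filter Topology

section gen
variable {n : ℕ}

/-- Elementary skew matrices, in coordinates. -/
def ee (a b : Fin n) : EE n := pr (Matrix.single a b (1:ℝ) - Matrix.single b a 1)

lemma sk_ee (a b : Fin n) : sk (ee a b) = Matrix.single a b (1:ℝ) - Matrix.single b a 1 := by
  apply sk_pr
  simp [Matrix.transpose_sub]

lemma ee_swap (a b : Fin n) : ee b a = - ee a b := by
  unfold ee
  rw [← map_neg, neg_sub]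

lemma ee_self (a : Fin n) : ee a a = 0 := by
  unfold ee
  rw [sub_self, map_zero]

lemma ee_pair (p : Pr n) : ee p.1.1 p.1.2 = Pi.single p 1 := by
  funext q
  have hp := p.2
  have hq := q.2
  rw [ee, pr_apply, Matrix.sub_apply, Matrix.single_apply, Matrix.single_apply, Pi.single_apply]
  have h2 : ¬ (p.1.2 = q.1.1 ∧ p.1.1 = q.1.2) := by
    rintro ⟨h1, h2⟩
    rw [h1, h2] at hp
    exact lt_asymm hp hq
  rw [if_neg h2, sub_zero]
  congr 1
  rw [Subtype.ext_iff, Prod.ext_iff, eq_iff_iff]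
  exact ⟨fun h => ⟨h.1.symm, h.2.symm⟩, fun h => ⟨h.1.symm, h.2.symm⟩⟩

lemma hk_single (c : Fin n → ℝ) (a d : Fin n) :
    hk c (Matrix.single a d 1 + Matrix.single d a 1) = (kap c a d / 2) • ee a d := by
  funext p
  have hp := p.2
  rw [hk_apply, Pi.smul_apply, ee, pr_apply, Matrix.add_apply, Matrix.sub_apply, smul_eq_mul]
  simp only [Matrix.single_apply]
  by_cases h1 : a = p.1.1 ∧ d = p.1.2
  · have h2 : ¬ (d = p.1.1 ∧ a = p.1.2) := by
      rintro ⟨h3, h4⟩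
      rw [← h4, ← h1.1] at hp
      exact lt_irrefl _ hp
    rw [if_pos h1, if_neg h2, ← h1.1, ← h1.2]; ring
  · by_cases h2 : d = p.1.1 ∧ a = p.1.2
    · rw [if_neg h1, if_pos h2, ← h2.1, ← h2.2, kap_swap c a d]; ring
    · rw [if_neg h1, if_neg h2]; ring

lemma single_mul (a b c d : Fin n) : (Matrix.single a b (1:ℝ)) * Matrix.single c d 1 =
    if b = c then Matrix.single a d 1 else 0 := by
  split_ifs with h
  · subst h; simp
  · exact Matrix.single_mul_single_of_ne _ _ _ _ h _

lemma BB_ee (κ : Fin n → ℝ) (a b c d : Fin n) : BB κ (ee a b) (ee c d) =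
    (if b = c then (kap κ a d / 2) • ee a d else 0) - (if b = d then (kap κ a c / 2) • ee a c else 0)
    - (if a = c then (kap κ b d / 2) • ee b d else 0)
    + (if a = d then (kap κ b c / 2) • ee b c else 0) := by
  have e : sk (ee a b) * sk (ee c d) + sk (ee c d) * sk (ee a b) =
      (if b = c then (Matrix.single a d 1 + Matrix.single d a 1) else 0)
      - (if b = d then (Matrix.single a c 1 + Matrix.single c a 1) else 0)
      - (if a = c then (Matrix.single b d 1 + Matrix.single d b 1) else 0)
      + (if a = d then (Matrix.single b c 1 + Matrix.single c b 1) else 0) := by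
    rw [sk_ee, sk_ee]
    simp only [sub_mul, mul_sub, single_mul, eq_comm (a := c), eq_comm (a := d)]
    split_ifs <;> abel
  rw [BB_apply, e, map_add, map_sub, map_sub]
  simp only [apply_ite (hk κ), hk_single, map_zero]

/-- The chain element. -/
def chain (n : ℕ) : EE n := ∑ i : Fin n, if h : i.1 + 1 < n then ee i ⟨i.1 + 1, h⟩ else 0

lemma kap_ne {κ : Fin n → ℝ} (hκ : ∀ i, 0 < κ i) (hi : Function.Injective κ) {i j : Fin n}
    (h : i ≠ j) : kap κ i j / 2 ≠ 0 := by
  have h1 := (add_pos (hκ i) (hκ j)).ne'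
  have h2 : κ i - κ j ≠ 0 := sub_ne_zero.2 fun e => h (hi e)
  unfold kap
  exact div_ne_zero (div_ne_zero h2 h1) two_ne_zero

theorem gen_chain {κ : Fin n → ℝ} (hκ : ∀ i, 0 < κ i) (hi : Function.Injective κ) (hn : 2 ≤ n) :
    Gen (BB κ) (chain n, ee ⟨0, by omega⟩ ⟨1, by omega⟩) := by
  intro W hg h01 hW
  dsimp only at hg h01
  have hmul : ∀ a b c : Fin n, a ≠ b → a ≠ c → b ≠ c → ee a b ∈ W → ee a c ∈ W → ee b c ∈ W := by
    intro a b c hab hac hbc h1 h2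
    have h3 := hW _ h1 _ h2
    rw [BB_ee, if_neg hab.symm, if_neg hbc, if_pos rfl, if_neg hac] at h3
    simp only [sub_zero, zero_sub, add_zero, neg_mem_iff] at h3
    exact (W.smul_mem_iff (kap_ne hκ hi hbc)).1 h3
  have h0 : ∀ k : ℕ, ∀ j : ℕ, j ≤ k → ∀ (hj : j < n),
      ee (⟨0, by omega⟩ : Fin n) ⟨j, hj⟩ ∈ W := by
    intro k
    induction k with
    | zero =>
      intro j hj hjn
      obtain rfl : j = 0 := by omega
      rw [ee_self]; exact W.zero_mem
    | succ k ih =>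
      intro j hj hjn
      rcases Nat.lt_or_ge j (k + 1) with hlt | hge
      · exact ih j (by omega) hjn
      obtain rfl : j = k + 1 := by omega
      rcases Nat.eq_zero_or_pos k with rfl | hk
      · exact h01
      have hkn : k < n := by omega
      have h3 := hW _ (ih k le_rfl hkn) _ hg
      rw [chain, map_sum, ← Finset.add_sum_erase _ _ (Finset.mem_univ (⟨k, hkn⟩ : Fin n))] at h3
      have h4 : ∑ i ∈ Finset.univ.erase (⟨k, hkn⟩ : Fin n),
          BB κ (ee ⟨0, by omega⟩ ⟨k, hkn⟩)
            (if h : i.1 + 1 < n then ee i ⟨i.1 + 1, h⟩ else 0) ∈ W := by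
        refine W.sum_mem fun i hik => ?_
        have hik : i ≠ ⟨k, hkn⟩ := (Finset.mem_erase.1 hik).1
        split_ifs with h
        swap
        · rw [map_zero]; exact W.zero_mem
        rw [BB_ee, if_neg hik.symm]
        refine W.add_mem (W.sub_mem (W.sub_mem W.zero_mem ?_) ?_) ?_
        · split_ifs with h5
          · refine W.smul_mem _ ?_
            rw [Fin.ext_iff] at h5
            exact ih i.1 (by simp at h5; omega) i.2
          · exact W.zero_mem
        · split_ifs with h5
          · refine W.smul_mem _ ?_
            subst h5
            rcases eq_or_ne k 1 with rfl | hk1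
            · rw [ee_self]; exact W.zero_mem
            rw [ee_swap]
            refine W.neg_mem (hmul ⟨0, by omega⟩ _ _ ?_ ?_ ?_ h01 (ih k le_rfl hkn))
            · simp
            · simp [Fin.ext_iff]; omega
            · simp [Fin.ext_iff]; omega
          · exact W.zero_mem
        · rw [if_neg (by simp [Fin.ext_iff])]; exact W.zero_mem
      have h5 := (W.add_mem_iff_left h4).1 h3
      rw [dif_pos hjn, BB_ee, if_pos rfl, if_neg (by simp [Fin.ext_iff]),
        if_neg (by simp [Fin.ext_iff]; omega), if_neg (by simp [Fin.ext_iff])] at h5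
      simp only [sub_zero, add_zero] at h5
      exact (W.smul_mem_iff (kap_ne hκ hi (by simp [Fin.ext_iff]))).1 h5
  rw [eq_top_iff, ← (Pi.basisFun ℝ (Pr n)).span_eq, Submodule.span_le]
  rintro _ ⟨p, rfl⟩
  rw [Pi.basisFun_apply, ← ee_pair]
  have hp := p.2
  by_cases hz : p.1.1 = ⟨0, by omega⟩
  · rw [hz]
    exact h0 n p.1.2.1 (by omega) p.1.2.2
  · refine hmul ⟨0, by omega⟩ _ _ (Ne.symm hz) ?_ hp.ne (h0 n p.1.1.1 (by omega) p.1.1.2)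
      (h0 n p.1.2.1 (by omega) p.1.2.2)
    intro h
    rw [← h, Fin.lt_def] at hp
    simp at hp

end gen
end MRB


namespace MRB
open Filter Topology

section final
variable {n : ℕ}

/-- Coordinates on skew matrices adapted to an orthogonal frame. -/
def Lam (U : Mat n) : EE n →ₗ[ℝ] Mat n where
  toFun x := U * sk x * Uᵀ
  map_add' x y := by rw [map_add, mul_add, add_mul]
  map_smul' r x := by rw [map_smul, Matrix.mul_smul, Matrix.smul_mul]; rfl

lemma Lam_apply (U : Mat n) (x : EE n) : Lam U x = U * sk x * Uᵀ := rfl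

lemma Lam_skew (U : Mat n) (x : EE n) : IsSkew (Lam U x) := by
  unfold IsSkew
  rw [Lam_apply, Matrix.transpose_mul, Matrix.transpose_mul, Matrix.transpose_transpose,
    sk_transpose]
  simp [Matrix.mul_assoc]

/-- Inverse coordinates. -/
def Lin (U : Mat n) (M : Mat n) : EE n := pr (Uᵀ * M * U)

lemma Lin_Lam {U : Mat n} (h : Uᵀ * U = 1) (x : EE n) : Lin U (Lam U x) = x := by
  rw [Lin, Lam_apply]
  rw [show Uᵀ * (U * sk x * Uᵀ) * U = (Uᵀ * U) * sk x * (Uᵀ * U) by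
    simp only [Matrix.mul_assoc], h, one_mul, mul_one, pr_sk]

lemma Lam_Lin {U : Mat n} (h : U * Uᵀ = 1) {M : Mat n} (hM : IsSkew M) :
    Lam U (Lin U M) = M := by
  rw [Lin, Lam_apply, sk_pr]
  · rw [show U * (Uᵀ * M * U) * Uᵀ = (U * Uᵀ) * M * (U * Uᵀ) by
      simp only [Matrix.mul_assoc], h, one_mul, mul_one]
  · have hM' : Mᵀ = -M := hM
    rw [Matrix.transpose_mul, Matrix.transpose_mul, Matrix.transpose_transpose, hM']
    simp [Matrix.mul_assoc]

lemma IC_Lam {U C : Mat n} {c : Fin n → ℝ} (h : Uᵀ * U = 1) (hC : C = U * diagonal c * Uᵀ)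
    (x : EE n) : IC C (Lam U x) = U * (sk x * diagonal c + diagonal c * sk x) * Uᵀ := by
  rw [IC, Lam_apply, hC, mul_add, add_mul]
  congr 1
  · rw [show U * sk x * Uᵀ * (U * diagonal c * Uᵀ) = U * sk x * (Uᵀ * U) * diagonal c * Uᵀ by
      simp only [Matrix.mul_assoc], h]
    simp only [Matrix.mul_assoc, Matrix.one_mul]
  · rw [show U * diagonal c * Uᵀ * (U * sk x * Uᵀ) = U * diagonal c * (Uᵀ * U) * sk x * Uᵀ by
      simp only [Matrix.mul_assoc], h]
    simp only [Matrix.mul_assoc, Matrix.one_mul]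

lemma IC_BB {U C : Mat n} {c : Fin n → ℝ} (hc : ∀ i, 0 < c i) (h : Uᵀ * U = 1)
    (hC : C = U * diagonal c * Uᵀ) (x : EE n) :
    IC C (Lam U (BB c x x)) = mbracket C (Lam U x ^ 2) := by
  have h2 : Lam U x ^ 2 = U * (sk x ^ 2) * Uᵀ := by
    rw [pow_two, pow_two, Lam_apply]
    rw [show U * sk x * Uᵀ * (U * sk x * Uᵀ) = U * sk x * (Uᵀ * U) * sk x * Uᵀ by
      simp only [Matrix.mul_assoc], h]
    simp only [Matrix.mul_assoc, Matrix.one_mul]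
  have h3 : mbracket C (Lam U x ^ 2) =
      U * (diagonal c * sk x ^ 2 - sk x ^ 2 * diagonal c) * Uᵀ := by
    rw [mbracket, h2, hC, mul_sub, sub_mul]
    congr 1
    · rw [show U * diagonal c * Uᵀ * (U * sk x ^ 2 * Uᵀ) =
        U * diagonal c * (Uᵀ * U) * sk x ^ 2 * Uᵀ by simp only [Matrix.mul_assoc], h]
      simp only [Matrix.mul_assoc, Matrix.one_mul]
    · rw [show U * sk x ^ 2 * Uᵀ * (U * diagonal c * Uᵀ) =
        U * sk x ^ 2 * (Uᵀ * U) * diagonal c * Uᵀ by simp only [Matrix.mul_assoc], h]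
      simp only [Matrix.mul_assoc, Matrix.one_mul]
  rw [h3, IC_Lam h hC]
  congr 2
  ext i j
  rw [Matrix.add_apply, Matrix.sub_apply, Matrix.mul_diagonal, Matrix.mul_diagonal,
    Matrix.diagonal_mul, Matrix.diagonal_mul, sk_BB_self, kap]
  have := (add_pos (hc i) (hc j)).ne'
  field_simp
  ring

lemma IC_add (C X Y : Mat n) : IC C (X + Y) = IC C X + IC C Y := by
  simp only [IC, add_mul, mul_add]; abel

lemma IC_smul (C X : Mat n) (r : ℝ) : IC C (r • X) = r • IC C X := by
  simp only [IC, Matrix.smul_mul, Matrix.mul_smul, smul_add]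

lemma IC_sub (C X Y : Mat n) : IC C (X - Y) = IC C X - IC C Y := by
  simp only [IC, sub_mul, mul_sub]; abel

theorem Steers_step {U C : Mat n} {c : Fin n → ℝ} (hc : ∀ i, 0 < c i) (h : Uᵀ * U = 1)
    (hC : C = U * diagonal c * Uᵀ) {ν : ℝ} {G1 Ω₀ : Mat n} {g h' : EE n} {x y : EE n}
    (hx : Steers C ν ![G1, Lam U g, Lam U h'] Ω₀ (Lam U x))
    (hs : Step (BB c) (Submodule.span ℝ {g, h'}) ν x y) :
    Steers C ν ![G1, Lam U g, Lam U h'] Ω₀ (Lam U y) := by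
  obtain ⟨T, u, Ω, k, t, hT, ht0, htk, htm, hΩc, hΩs, hΩ0, hΩT, hu, hd⟩ := hx
  obtain ⟨T', hT', w, hw, γ, hγ0, hγ1, hγ⟩ := hs
  obtain ⟨a, b, rfl⟩ := Submodule.mem_span_pair.1 hw
  have htle : ∀ i, i ≤ k → t i ≤ T := by
    intro i hi
    rw [← htk]
    have : ∀ j, i + j ≤ k → t i ≤ t (i + j) := by
      intro j
      induction j with
      | zero => intro _; exact le_rfl
      | succ j ih => intro hj; exact (ih (by omega)).trans (htm (i + j) (by omega)).le
    have := this (k - i) (by omega)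
    rwa [Nat.add_sub_cancel' hi] at this
  set Γ : ℝ → Mat n := fun s => Lam U (γ ((s - T) / T')) with hΓ
  have hΓT : Γ T = Ω T := by simp [hΓ, hγ0, hΩT]
  have hΓc : ContinuousOn Γ (Icc T (T + T')) := by
    have h1 : Continuous (Lam U) := (Lam U).continuous_of_finiteDimensional
    refine h1.comp_continuousOn (hγ.continuousOn.comp (by fun_prop) ?_)
    intro s hs
    exact ⟨div_nonneg (by linarith [hs.1]) hT'.le, (div_le_one hT').2 (by linarith [hs.2])⟩
  refine ⟨T + T', fun j s => if s < T then u j s else (![0, a, b] : Fin 3 → ℝ) j,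
    fun s => if s ≤ T then Ω s else Γ s, k + 1, fun i => if i ≤ k then t i else T + T',
    by linarith, by simp [ht0], by simp, ?_, ?_, ?_, ?_, ?_, ?_, ?_⟩
  · intro i hi
    rcases Nat.lt_or_ge i k with hik | hik
    · simp only [show i ≤ k by omega, show i + 1 ≤ k by omega, if_true]
      exact htm i hik
    · obtain rfl : i = k := by omega
      simp [htk, hT']
  · rw [← Icc_union_Icc_eq_Icc hT (by linarith : T ≤ T + T')]
    refine ContinuousOn.union_of_isClosed ?_ ?_ isClosed_Icc isClosed_Icc
    · refine hΩc.congr fun s hs => ?_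
      simp [hs.2]
    · refine hΓc.congr fun s hs => ?_
      rcases eq_or_lt_of_le hs.1 with rfl | hlt
      · simp [hΓT]
      · simp [hlt.not_ge]
  · intro s hs
    by_cases hsT : s ≤ T
    · simp only [hsT, if_true]; exact hΩs s ⟨hs.1, hsT⟩
    · simp only [hsT, if_false]; exact Lam_skew U _
  · simp [hT, hΩ0]
  · simp only [show ¬ (T + T' ≤ T) by linarith, if_false, hΓ]
    rw [add_sub_cancel_left, div_self hT'.ne', hγ1]
  · intro i hi j
    rcases Nat.lt_or_ge i k with hik | hik
    · obtain ⟨r, hr⟩ := hu i hik j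
      refine ⟨r, fun s hs => ?_⟩
      simp only [show i ≤ k by omega, show i + 1 ≤ k by omega, if_true] at hs
      beta_reduce
      rw [if_pos (hs.2.trans_le (htle _ (by omega)))]
      exact hr s hs
    · obtain rfl : i = k := by omega
      refine ⟨(![0, a, b] : Fin 3 → ℝ) j, fun s hs => ?_⟩
      simp [htk] at hs
      beta_reduce
      rw [if_neg hs.1.not_gt]
  · intro i hi s hs
    rcases Nat.lt_or_ge i k with hik | hik
    · simp only [show i ≤ k by omega, show i + 1 ≤ k by omega, if_true] at hs
      obtain ⟨D, hD, hE⟩ := hd i hik s hs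
      have hsT : s < T := hs.2.trans_le (htle _ (by omega))
      refine ⟨D, fun p q => ?_, ?_⟩
      · refine (hD p q).congr_of_eventuallyEq ?_
        filter_upwards [Iio_mem_nhds hsT] with r hr
        rw [if_pos (le_of_lt hr)]
      · simp only [hsT, hsT.le, if_true]
        exact hE
    · obtain rfl : i = k := by omega
      simp [htk] at hs
      have hr1 : 0 < (s - T) / T' := div_pos (by linarith) hT'
      have hr2 : (s - T) / T' < 1 := (div_lt_one hT').2 (by linarith)
      set r := (s - T) / T' with hr
      refine ⟨Lam U (vf (BB c) ν (a • g + b • h') (γ r)), fun p q => ?_, ?_⟩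
      · have h1 : HasDerivAt γ (T' • vf (BB c) ν (a • g + b • h') (γ r)) r :=
          (hγ r ⟨hr1.le, hr2.le⟩).hasDerivAt (Icc_mem_nhds hr1 hr2)
        have h2 : HasDerivAt (fun s : ℝ => (s - T) / T') (1 / T') s :=
          ((hasDerivAt_id s).sub_const T).div_const T'
        have h3 := h1.scomp s h2
        rw [smul_smul, one_div, inv_mul_cancel₀ hT'.ne', one_smul] at h3
        let L : EE n →ₗ[ℝ] ℝ :=
          { toFun := fun z => Lam U z p q
            map_add' := fun z z' => by rw [map_add]; rfl
            map_smul' := fun d z => by rw [map_smul]; rfl }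
        have h4 := (LinearMap.toContinuousLinearMap L).hasFDerivAt.comp_hasDerivAt s h3
        refine HasDerivAt.congr_of_eventuallyEq (f := fun τ => Γ τ p q) h4 ?_
        filter_upwards [Ioi_mem_nhds hs.1] with z hz
        rw [if_neg (not_le.2 hz)]
      · beta_reduce
        rw [if_neg (not_le.2 hs.1)]
        simp only [hs.1.not_gt, if_false, Fin.sum_univ_three]
        simp only [hΓ, ← hr, vf, map_add, map_sub, map_smul, IC_add, IC_sub, IC_smul,
          IC_BB hc h hC]
        simp

theorem Steers_reach {U C : Mat n} {c : Fin n → ℝ} (hc : ∀ i, 0 < c i) (h : Uᵀ * U = 1)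
    (hC : C = U * diagonal c * Uᵀ) {ν : ℝ} {G1 : Mat n} {g h' : EE n} {x y : EE n}
    (hs : Reach (BB c) (Submodule.span ℝ {g, h'}) ν x y) :
    Steers C ν ![G1, Lam U g, Lam U h'] (Lam U x) (Lam U y) := by
  unfold Reach at hs
  induction hs with
  | refl =>
    refine ⟨0, fun _ _ => 0, fun _ => Lam U x, 0, fun _ => 0, le_rfl, rfl, rfl, by simp,
      continuousOn_const, fun _ _ => Lam_skew U x, rfl, rfl, by simp, by simp⟩
  | tail _ hst ih => exact Steers_step hc h hC ih hst

/-- Coordinates as a homeomorphism. -/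
def hom {U : Mat n} (h1 : Uᵀ * U = 1) (h2 : U * Uᵀ = 1) : {G : Mat n // IsSkew G} ≃ₜ EE n where
  toFun G := Lin U G.1
  invFun x := ⟨Lam U x, Lam_skew U x⟩
  left_inv G := Subtype.ext (Lam_Lin h2 G.2)
  right_inv x := Lin_Lam h1 x
  continuous_toFun := by
    have : Continuous (pr : Mat n →ₗ[ℝ] EE n) := LinearMap.continuous_of_finiteDimensional _
    exact this.comp (by fun_prop)
  continuous_invFun :=
    Continuous.subtype_mk (LinearMap.continuous_of_finiteDimensional (Lam U)) _

end final
end MRB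

/-- **Theorem 4 (damped MRB, even `n`, three torques).** For even `n ≥ 4`, symmetric positive
definite `C` with distinct eigenvalues and `ν ≥ 0`, there are a relatively open dense subset
`𝒮` of the set `S = {G ∈ so(n) | [C, G²] = 0}` of steady directions and an open dense subset
`𝓟` of `so(n) × so(n)` such that for every `G¹ ∈ 𝒮` and every pair `(G², G³) ∈ 𝓟` the damped
three-torque Euler–Frahm system is globally controllable. -/
theorem mrb_global_controllability_damped_even
    (n : ℕ) (hn : 4 ≤ n) (heven : Even n) (C : Mat n) (hC : C.PosDef)
    (hdist : Function.Injective hC.1.eigenvalues) (ν : ℝ) (hν : 0 ≤ ν) :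
    ∃ 𝒮 : Set {G : Mat n // IsSkew G ∧ mbracket C (G ^ 2) = 0},
    ∃ 𝓟 : Set ({G : Mat n // IsSkew G} × {G : Mat n // IsSkew G}),
      IsOpen 𝒮 ∧ Dense 𝒮 ∧ IsOpen 𝓟 ∧ Dense 𝓟 ∧
      ∀ G1 ∈ 𝒮, ∀ p ∈ 𝓟, ∀ Ω₀ Ω₁ : Mat n, IsSkew Ω₀ → IsSkew Ω₁ →
        Steers C ν ![(G1 : {G : Mat n // IsSkew G ∧ mbracket C (G ^ 2) = 0}).1,
                     (p : {G : Mat n // IsSkew G} × {G : Mat n // IsSkew G}).1.1,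
                     (p : {G : Mat n // IsSkew G} × {G : Mat n // IsSkew G}).2.1] Ω₀ Ω₁ := by
  classical
  set c := hC.1.eigenvalues with hcdef
  have hc : ∀ i, 0 < c i := hC.eigenvalues_pos
  set U : Mat n := (hC.1.eigenvectorUnitary : Mat n) with hU
  have hst : star U = Uᵀ := by
    rw [Matrix.star_eq_conjTranspose, Matrix.conjTranspose_eq_transpose_of_trivial]
  have h1 : Uᵀ * U = 1 := by
    rw [← hst]; exact Unitary.coe_star_mul_self hC.1.eigenvectorUnitary
  have h2 : U * Uᵀ = 1 := by
    rw [← hst]; exact Unitary.coe_mul_star_self hC.1.eigenvectorUnitary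
  have hCU : C = U * diagonal c * Uᵀ := by
    have := hC.1.spectral_theorem
    rw [Unitary.conjStarAlgAut_apply] at this
    rw [← hst]
    exact this
  obtain ⟨P, hPo, hPd, hP⟩ :=
    MRB.generic_gen (MRB.gen_chain hc hdist (by omega : 2 ≤ n))
  obtain ⟨m, hm, hQm⟩ := MRB.QQ_pos c hc
  let Φ := (MRB.hom h1 h2).prodCongr (MRB.hom h1 h2)
  refine ⟨univ, Φ ⁻¹' P, isOpen_univ, dense_univ, hPo.preimage Φ.continuous,
    hPd.preimage Φ.isOpenMap, ?_⟩
  intro G1 _ p hp Ω₀ Ω₁ hΩ₀ hΩ₁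
  have hgen := hP _ hp
  have e1 : p.1.1 = MRB.Lam U (Φ p).1 := (MRB.Lam_Lin h2 p.1.2).symm
  have e2 : p.2.1 = MRB.Lam U (Φ p).2 := (MRB.Lam_Lin h2 p.2.2).symm
  rw [e1, e2, ← MRB.Lam_Lin h2 hΩ₀, ← MRB.Lam_Lin h2 hΩ₁]
  refine MRB.Steers_reach hc h1 hCU ?_
  refine MRB.global_reach (MRB.BB_symm c) (MRB.BB_trace c) (MRB.QQ_symm c) (MRB.QQ_zero c hc)
    hm hQm ?_ ν _ _
  intro W hVW hW
  exact hgen W (hVW (Submodule.subset_span (by simp))) (hVW (Submodule.subset_span (by simp))) hW
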